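/- arXiv:2106.04002 — 2 statements merged into one kernel-verified Lean document; each statement's English description precedes it below -/
import Mathlib

section
/- Let 1 ≤ p < ∞, let ρ ⊆ [0,1) have 1 as a limit point, and let K ⊆ 𝕋 be compact with m(K) = 0. For every j, l ∈ ℕ and s ∈ ℕ*, and for every ε > 0, there exist r ∈ ρ and f ∈ U(j,s,l,r) with ‖f‖_{H^p} < ε; that is, ⋃_{r∈ρ} U(j,s,l,r) intersects every neighbourhood of 0 in H^p(𝔻). -/
open Complex Metric Set Filter MeasureTheory Polynomial Topology

noncomputable section

/-- The Hardy `p`-norm of a function `f` on the unit disk: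
`sup_{0<r<1} ((1/2π) ∫_0^{2π} |f(r e^{iθ})|^p dθ)^{1/p}`. -/
def hardyNorm (p : ℝ) (f : ℂ → ℂ) : ℝ :=
  ⨆ r : Set.Ioo (0:ℝ) 1,
    ((1 / (2 * Real.pi)) *
      ∫ θ in (0:ℝ)..(2 * Real.pi),
        ‖f (((r : ℝ) : ℂ) * Complex.exp ((θ : ℂ) * Complex.I))‖ ^ p) ^ (1 / p)

/-- Membership in the Hardy space `H^p(𝔻)`: `f` is holomorphic on the unit disk and the
means `((1/2π) ∫_0^{2π} |f(r e^{iθ})|^p dθ)^{1/p}` are uniformly bounded for `0 < r < 1`. -/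
def MemHp (p : ℝ) (f : ℂ → ℂ) : Prop :=
  DifferentiableOn ℂ f (Metric.ball (0:ℂ) 1) ∧
  BddAbove (Set.range fun r : Set.Ioo (0:ℝ) 1 =>
    ((1 / (2 * Real.pi)) *
      ∫ θ in (0:ℝ)..(2 * Real.pi),
        ‖f (((r : ℝ) : ℂ) * Complex.exp ((θ : ℂ) * Complex.I))‖ ^ p) ^ (1 / p))

/-- The Hardy space `H^p(𝔻)` as a type. -/
def HpSpace (p : ℝ) := {f : ℂ → ℂ // MemHp p f}

/-- The norm topology on `H^p(𝔻)`, generated by the open balls of the Hardy norm. -/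
instance hpTopology (p : ℝ) : TopologicalSpace (HpSpace p) :=
  TopologicalSpace.generateFrom
    {U : Set (HpSpace p) | ∃ (f : HpSpace p) (ε : ℝ), 0 < ε ∧
      U = {g : HpSpace p | hardyNorm p (fun z => g.1 z - f.1 z) < ε}}

/-- The arc length measure of a subset `K` of the unit circle `𝕋 ⊆ ℂ`, computed as the
Lebesgue measure of the set of angles `θ ∈ [0, 2π)` with `e^{iθ} ∈ K`. -/
def arcMeasure (K : Set ℂ) : ENNReal :=
  MeasureTheory.volume {θ : ℝ | θ ∈ Set.Ico (0:ℝ) (2 * Real.pi) ∧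
    Complex.exp ((θ : ℂ) * Complex.I) ∈ K}

/-- A complex polynomial has rational coefficients if the real and imaginary part of each
coefficient is rational. -/
def RatPoly (q : Polynomial ℂ) : Prop :=
  ∀ n : ℕ, ∃ a b : ℚ, q.coeff n = (a : ℂ) + (b : ℂ) * Complex.I

/-- The set `U(j,s,l,r)` of `f ∈ H^p(𝔻)` with
`sup_{ζ∈K} sup_{|z| ≤ s/(s+1)} |f^{(l)}(r(ζ-z)+z) - P_j(ζ)| < 1/s`. -/
def UHpD (p : ℝ) (K : Set ℂ) (P : ℕ → Polynomial ℂ) (j s l : ℕ) (r : ℝ) :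
    Set (HpSpace p) :=
  {f : HpSpace p |
    (⨆ ζ ∈ K, ⨆ z ∈ Metric.closedBall (0:ℂ) ((s : ℝ) / ((s : ℝ) + 1)),
      ‖iteratedDeriv l f.1 ((r : ℂ) * (ζ - z) + z) - (P j).eval ζ‖) < 1 / (s : ℝ)}

theorem exists_finset_cover_of_hausdorffMeasure_eq_zero {X : Type*} [MetricSpace X] [Nonempty X]
    [MeasurableSpace X] [BorelSpace X] {K : Set X} (hK : IsCompact K)
    (h0 : Measure.hausdorffMeasure 1 K = 0) {η : ℝ} (hη : 0 < η) :
    ∃ (T : Finset ℕ) (c : ℕ → X) (δ : ℕ → ℝ), (∀ k ∈ T, c k ∈ K ∧ 0 < δ k) ∧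
      ∑ k ∈ T, δ k < η ∧ ∀ ζ ∈ K, ∃ k ∈ T, dist ζ (c k) < δ k := by
  classical
  set e : ENNReal := ENNReal.ofReal (η / 2)
  have he : 0 < e := ENNReal.ofReal_pos.2 (by linarith)
  have h1 : (⨅ (t : ℕ → Set X) (_ : K ⊆ ⋃ n, t n) (_ : ∀ n, Metric.ediam (t n) ≤ 1),
      ∑' n, ⨆ _ : (t n).Nonempty, Metric.ediam (t n) ^ (1 : ℝ)) < e := by
    refine lt_of_le_of_lt ?_ he
    rw [← h0, Measure.hausdorffMeasure_apply]
    exact le_iSup₂_of_le (1 : ENNReal) one_pos le_rfl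
  simp only [iInf_lt_iff] at h1
  obtain ⟨t, htK, htd, hte⟩ := h1
  obtain ⟨ε', hε'0, hε'⟩ := ENNReal.exists_pos_sum_of_countable he.ne' ℕ
  obtain ⟨x₀⟩ := ‹Nonempty X›
  have hx : ∀ n, ∃ x, (t n ∩ K).Nonempty → x ∈ t n ∩ K := fun n => by
    by_cases h : (t n ∩ K).Nonempty
    · exact ⟨h.some, fun _ => h.some_mem⟩
    · exact ⟨x₀, fun h' => absurd h' h⟩
  choose c hc using hx
  set δ : ℕ → ℝ := fun n => (Metric.ediam (t n)).toReal + ε' n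
  have hfin : ∀ n, Metric.ediam (t n) ≠ ⊤ := fun n => ne_top_of_le_ne_top ENNReal.one_ne_top (htd n)
  have hδ : ∀ n, 0 < δ n := fun n => add_pos_of_nonneg_of_pos ENNReal.toReal_nonneg (hε'0 n)
  obtain ⟨T, hT⟩ := hK.elim_finite_subcover
    (fun n => if (t n ∩ K).Nonempty then Metric.ball (c n) (δ n) else ∅)
    (fun n => by split_ifs <;> simp [Metric.isOpen_ball]) (by
      intro x hx
      obtain ⟨n, hn⟩ := Set.mem_iUnion.1 (htK hx)
      have hN : (t n ∩ K).Nonempty := ⟨x, hn, hx⟩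
      refine Set.mem_iUnion.2 ⟨n, ?_⟩
      rw [if_pos hN, Metric.mem_ball]
      have h2 : dist x (c n) ≤ (Metric.ediam (t n)).toReal := by
        rw [dist_edist]
        exact ENNReal.toReal_mono (hfin n) (Metric.edist_le_ediam_of_mem hn (hc n hN).1)
      have := hε'0 n
      exact h2.trans_lt (lt_add_of_pos_right _ (by exact_mod_cast this)))
  refine ⟨T.filter fun n => (t n ∩ K).Nonempty, c, δ, fun k hk =>
    ⟨(hc k (Finset.mem_filter.1 hk).2).2, hδ k⟩, ?_, ?_⟩
  · rw [← ENNReal.ofReal_lt_ofReal_iff hη, ENNReal.ofReal_sum_of_nonneg fun k _ => (hδ k).le]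
    calc ∑ k ∈ T.filter fun n => (t n ∩ K).Nonempty, ENNReal.ofReal (δ k)
        ≤ ∑ k ∈ T.filter fun n => (t n ∩ K).Nonempty,
            ((⨆ _ : (t k).Nonempty, Metric.ediam (t k) ^ (1 : ℝ)) + ε' k) := by
          refine Finset.sum_le_sum fun k hk => ?_
          have hN := (Finset.mem_filter.1 hk).2
          rw [ciSup_pos (hN.mono Set.inter_subset_left), ENNReal.rpow_one,
            ENNReal.ofReal_add ENNReal.toReal_nonneg (by positivity),
            ENNReal.ofReal_toReal (hfin k), ENNReal.ofReal_coe_nnreal]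
      _ ≤ ∑' k, ((⨆ _ : (t k).Nonempty, Metric.ediam (t k) ^ (1 : ℝ)) + ε' k) :=
          ENNReal.sum_le_tsum _
      _ = _ + _ := ENNReal.tsum_add
      _ < e + e := ENNReal.add_lt_add hte hε'
      _ = ENNReal.ofReal η := by
          rw [← ENNReal.ofReal_add (by linarith) (by linarith), add_halves]
  · intro ζ hζ
    obtain ⟨n, hn, h⟩ := Set.mem_iUnion₂.1 (hT hζ)
    split_ifs at h with hN
    · exact ⟨n, Finset.mem_filter.2 ⟨hn, hN⟩, h⟩
    · exact h.elim

theorem hausdorffMeasure_eq_zero_of_arcMeasure_eq_zero {K : Set ℂ}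
    (hKT : K ⊆ Metric.sphere (0 : ℂ) 1) (hK : arcMeasure K = 0) :
    Measure.hausdorffMeasure 1 K = 0 := by
  have hL : LipschitzWith 1 fun θ : ℝ => Complex.exp ((θ : ℂ) * Complex.I) := by
    refine LipschitzWith.of_dist_le_mul fun x y => ?_
    have h : Complex.exp ((x : ℂ) * Complex.I) - Complex.exp ((y : ℂ) * Complex.I) =
        Complex.exp ((y : ℂ) * Complex.I) * (Complex.exp (Complex.I * ((x - y : ℝ) : ℂ)) - 1) := by
      rw [mul_sub, ← Complex.exp_add]
      push_cast
      ring_nf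
    rw [dist_eq_norm, h, norm_mul, Complex.norm_exp_ofReal_mul_I, one_mul, NNReal.coe_one, one_mul,
      dist_eq_norm]
    exact Real.norm_exp_I_mul_ofReal_sub_one_le
  refine le_antisymm ?_ zero_le
  calc Measure.hausdorffMeasure 1 K
      ≤ Measure.hausdorffMeasure 1 ((fun θ : ℝ => Complex.exp ((θ : ℂ) * Complex.I)) ''
          {θ : ℝ | θ ∈ Set.Ico (0 : ℝ) (2 * Real.pi) ∧
            Complex.exp ((θ : ℂ) * Complex.I) ∈ K}) := by
        refine measure_mono fun z hz => ?_
        have hz1 : ‖z‖ = 1 := by simpa using hKT hz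
        obtain ⟨θ, hθ, h⟩ : ∃ θ ∈ Set.Ico (0 : ℝ) (2 * Real.pi),
            Complex.exp ((θ : ℂ) * Complex.I) = z := by
          refine ⟨toIcoMod Real.two_pi_pos 0 z.arg,
            by simpa using toIcoMod_mem_Ico Real.two_pi_pos 0 z.arg, ?_⟩
          have h2 := Complex.norm_mul_exp_arg_mul_I z
          rw [hz1, Complex.ofReal_one, one_mul] at h2
          refine Eq.trans (Complex.exp_eq_exp_iff_exists_int.2
            ⟨-toIcoDiv Real.two_pi_pos 0 z.arg, ?_⟩) h2
          rw [toIcoMod]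
          push_cast [zsmul_eq_mul]
          ring
        exact ⟨θ, ⟨hθ, by rwa [h]⟩, h⟩
    _ ≤ _ := hL.hausdorffMeasure_image_le zero_le_one _
    _ = 0 := by
        rw [MeasureTheory.hausdorffMeasure_real]
        rw [← arcMeasure, hK, mul_zero]

theorem exists_antideriv_le_re {R M : ℝ} (hR : 1 ≤ R) {f h : ℂ → ℂ}
    (hf : DifferentiableOn ℂ f (Metric.ball 0 R)) (hh : DifferentiableOn ℂ h (Metric.ball 0 1))
    (hM : ∀ z ∈ Metric.ball (0 : ℂ) 1, ‖f z‖ ≤ M)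
    (hfh : ∀ z ∈ Metric.ball (0 : ℂ) 1, ‖f z‖ ≤ (h z).re) :
    ∃ F H : ℂ → ℂ, (∀ z ∈ Metric.ball (0 : ℂ) R, HasDerivAt F (f z) z) ∧
      DifferentiableOn ℂ H (Metric.ball 0 1) ∧ H 0 = h 0 ∧
      (∀ z ∈ Metric.ball (0 : ℂ) 1, ‖F z‖ ≤ M) ∧
      ∀ z ∈ Metric.ball (0 : ℂ) 1, ‖F z‖ ≤ (H z).re := by
  obtain ⟨F, hF0, hF⟩ := hf.isExactOn_ball.with_val_at 0 0
  obtain ⟨W, hW0, hW⟩ := hh.isExactOn_ball.with_val_at 0 0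
  have h01 : (0 : ℂ) ∈ Metric.ball (0 : ℂ) 1 := by simp
  have hW0' : dslope W 0 0 = h 0 := by rw [dslope_same, (hW 0 h01).deriv]
  refine ⟨F, dslope W 0, hF, ?_, hW0', ?_, ?_⟩
  · rw [Complex.differentiableOn_dslope (Metric.ball_mem_nhds 0 one_pos)]
    exact fun z hz => (hW z hz).differentiableAt.differentiableWithinAt
  · intro z hz
    have h1 := Convex.norm_image_sub_le_of_norm_deriv_le (f := F) (C := M)
      (fun x hx => (hF x (Metric.ball_subset_ball hR hx)).differentiableAt)
      (fun x hx => by rw [(hF x (Metric.ball_subset_ball hR hx)).deriv]; exact hM x hx)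
      (convex_ball (0 : ℂ) 1) h01 hz
    rw [hF0, sub_zero, sub_zero] at h1
    have h2 : ‖z‖ < 1 := by simpa using hz
    have h3 : 0 ≤ M := (norm_nonneg _).trans (hM z hz)
    exact h1.trans (mul_le_of_le_one_right h3 h2.le)
  · intro z hz
    have hz1 : ‖z‖ < 1 := by simpa using hz
    rcases eq_or_ne z 0 with rfl | hz0
    · rw [hF0, hW0', norm_zero]
      exact (norm_nonneg _).trans (hfh 0 h01)
    rw [dslope_of_ne _ hz0, slope_def_field, hW0, sub_zero, sub_zero]
    have hmem : ∀ t ∈ Set.Icc (0 : ℝ) 1, (t : ℂ) * z ∈ Metric.ball (0 : ℂ) 1 := fun t ht => by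
      rw [mem_ball_zero_iff, norm_mul, Complex.norm_real, Real.norm_of_nonneg ht.1]
      exact (mul_le_of_le_one_left (norm_nonneg z) ht.2).trans_lt hz1
    have hray : ∀ t : ℝ, HasDerivAt (fun t : ℝ => (t : ℂ) * z) z t := fun t => by
      simpa using (Complex.ofRealCLM.hasDerivAt (x := t)).mul_const z
    have hFd : ∀ t ∈ Set.Icc (0 : ℝ) 1,
        HasDerivAt (fun t : ℝ => F ((t : ℂ) * z)) (f (t * z) * z) t := fun t ht =>
      (hF _ (Metric.ball_subset_ball hR (hmem t ht))).comp t (hray t)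
    have hWd : ∀ t ∈ Set.Icc (0 : ℝ) 1,
        HasDerivAt (fun t : ℝ => (W ((t : ℂ) * z) / z).re) (h (t * z)).re t := fun t ht => by
      have h1 : HasDerivAt (fun t : ℝ => W ((t : ℂ) * z) / z) (h (t * z) * z / z) t :=
        ((hW _ (hmem t ht)).comp t (hray t)).div_const z
      rw [mul_div_cancel_right₀ _ hz0] at h1
      exact Complex.reCLM.hasFDerivAt.comp_hasDerivAt t h1
    have key := image_norm_le_of_norm_deriv_right_le_deriv_boundary'
      (fun t ht => (hFd t ht).continuousAt.continuousWithinAt)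
      (fun t ht => (hFd t (Set.Ico_subset_Icc_self ht)).hasDerivWithinAt)
      (by simp [hF0, hW0])
      (fun t ht => (hWd t ht).continuousAt.continuousWithinAt)
      (fun t ht => (hWd t (Set.Ico_subset_Icc_self ht)).hasDerivWithinAt)
      (fun t ht => by
        rw [norm_mul]
        exact (mul_le_of_le_one_right (norm_nonneg _) hz1.le).trans
          (hfh _ (hmem t (Set.Ico_subset_Icc_self ht))))
      (Set.right_mem_Icc.2 zero_le_one)
    simpa using key

theorem exists_iteratedDeriv_eqOn_le_re {R M : ℝ} (hR : 1 ≤ R) (l : ℕ) {f h : ℂ → ℂ}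
    (hf : DifferentiableOn ℂ f (Metric.ball 0 R)) (hh : DifferentiableOn ℂ h (Metric.ball 0 1))
    (hM : ∀ z ∈ Metric.ball (0 : ℂ) 1, ‖f z‖ ≤ M)
    (hfh : ∀ z ∈ Metric.ball (0 : ℂ) 1, ‖f z‖ ≤ (h z).re) :
    ∃ F H : ℂ → ℂ, Set.EqOn (iteratedDeriv l F) f (Metric.ball 0 R) ∧
      DifferentiableOn ℂ F (Metric.ball 0 R) ∧
      DifferentiableOn ℂ H (Metric.ball 0 1) ∧ H 0 = h 0 ∧
      (∀ z ∈ Metric.ball (0 : ℂ) 1, ‖F z‖ ≤ M) ∧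
      ∀ z ∈ Metric.ball (0 : ℂ) 1, ‖F z‖ ≤ (H z).re := by
  induction l generalizing f h with
  | zero => exact ⟨f, h, by simp [Set.eqOn_refl], hf, hh, rfl, hM, hfh⟩
  | succ l ih =>
    obtain ⟨f₁, h₁, hf₁, hh₁, h0, hM₁, hfh₁⟩ := exists_antideriv_le_re hR hf hh hM hfh
    obtain ⟨F, H, hF, hFd, hHd, hH0, hFM, hFH⟩ :=
      ih (fun z hz => (hf₁ z hz).differentiableAt.differentiableWithinAt) hh₁ hM₁ hfh₁
    refine ⟨F, H, fun z hz => ?_, hFd, hHd, hH0.trans h0, hFM, hFH⟩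
    rw [iteratedDeriv_succ, (hF.eventuallyEq_of_mem (Metric.isOpen_ball.mem_nhds hz)).deriv_eq,
      (hf₁ z hz).deriv]

theorem hardyMean_le {p M : ℝ} (hp : 1 ≤ p) {F H : ℂ → ℂ}
    (hF : DifferentiableOn ℂ F (Metric.ball 0 1)) (hH : DifferentiableOn ℂ H (Metric.ball 0 1))
    (hM : ∀ z ∈ Metric.ball (0 : ℂ) 1, ‖F z‖ ≤ M)
    (hFH : ∀ z ∈ Metric.ball (0 : ℂ) 1, ‖F z‖ ≤ (H z).re) (r : Set.Ioo (0 : ℝ) 1) :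
    ((1 / (2 * Real.pi)) * ∫ θ in (0 : ℝ)..(2 * Real.pi),
      ‖F (((r : ℝ) : ℂ) * Complex.exp ((θ : ℂ) * Complex.I))‖ ^ p) ^ (1 / p) ≤
      (M ^ (p - 1) * (H 0).re) ^ (1 / p) := by
  obtain ⟨r, hr0, hr1⟩ := r
  have hM0 : 0 ≤ M := (norm_nonneg _).trans (hM 0 (by simp))
  have hcl : Metric.closedBall (0 : ℂ) |r| ⊆ Metric.ball 0 1 :=
    Metric.closedBall_subset_ball (by rwa [abs_of_pos hr0])
  have hmem : ∀ θ, circleMap 0 r θ ∈ Metric.ball (0 : ℂ) 1 := fun θ => hcl (by simp)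
  have hpow : ∀ z ∈ Metric.ball (0 : ℂ) 1, ‖F z‖ ^ p ≤ M ^ (p - 1) * (H z).re := fun z hz => by
    calc ‖F z‖ ^ p = ‖F z‖ ^ (p - 1) * ‖F z‖ := by
          rw [← Real.rpow_add_one' (norm_nonneg _) (by linarith), sub_add_cancel]
      _ ≤ _ := mul_le_mul (Real.rpow_le_rpow (norm_nonneg _) (hM z hz) (by linarith)) (hFH z hz)
          (norm_nonneg _) (Real.rpow_nonneg hM0 _)
  have hHavg : Real.circleAverage (fun z => (H z).re) 0 r = (H 0).re := by
    have h1 : Real.circleAverage H 0 r = H 0 :=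
      DiffContOnCl.circleAverage (hH.diffContOnCl_ball hcl)
    have h2 : CircleIntegrable H 0 r :=
      ((hH.continuousOn.mono hcl).mono Metric.sphere_subset_closedBall).circleIntegrable'
    rw [← h1]
    exact Complex.reCLM.circleAverage_comp_comm h2
  have hcF : Continuous fun θ => ‖F (circleMap 0 r θ)‖ ^ p :=
    ((hF.continuousOn.comp_continuous (continuous_circleMap 0 r) hmem).norm).rpow_const
      fun _ => Or.inr (by linarith)
  have hcH : Continuous fun θ => M ^ (p - 1) * (H (circleMap 0 r θ)).re :=
    continuous_const.mul
      (Complex.continuous_re.comp (hH.continuousOn.comp_continuous (continuous_circleMap 0 r) hmem))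
  have hint : (∫ θ in (0 : ℝ)..(2 * Real.pi), ‖F (circleMap 0 r θ)‖ ^ p) ≤
      ∫ θ in (0 : ℝ)..(2 * Real.pi), M ^ (p - 1) * (H (circleMap 0 r θ)).re :=
    intervalIntegral.integral_mono_on Real.two_pi_pos.le (hcF.intervalIntegrable _ _)
      (hcH.intervalIntegrable _ _) fun θ _ => hpow _ (hmem θ)
  refine Real.rpow_le_rpow (mul_nonneg (by positivity) (intervalIntegral.integral_nonneg
    Real.two_pi_pos.le fun θ _ => by positivity)) ?_ (by positivity)
  rw [← hHavg, Real.circleAverage_def, smul_eq_mul, one_div, mul_left_comm]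
  rw [intervalIntegral.integral_const_mul] at hint
  simp only [circleMap, zero_add] at hint ⊢
  exact mul_le_mul_of_nonneg_left hint (by positivity)

theorem exists_holomorphic_peak {K : Set ℂ} (hK : IsCompact K)
    (hKT : K ⊆ Metric.sphere (0 : ℂ) 1) (h0 : Measure.hausdorffMeasure 1 K = 0)
    {η κ : ℝ} (hη : 0 < η) (hκ : 0 < κ) :
    ∃ (R : ℝ) (g : ℂ → ℂ), 1 < R ∧ DifferentiableOn ℂ g (Metric.ball 0 R) ∧
      (∀ z ∈ Metric.ball (0 : ℂ) R, ‖g z‖ ^ 2 ≤ (g z).re) ∧ (g 0).re ≤ η ∧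
      ∀ ζ ∈ K, ‖g ζ - 1‖ ≤ κ := by
  set A : ℝ := 4 / κ with hA
  have hA0 : 0 < A := by positivity
  obtain ⟨T, c, δ, hT, hsum, hcov⟩ :=
    exists_finset_cover_of_hausdorffMeasure_eq_zero hK h0 (div_pos hη hA0)
  have hc : ∀ k ∈ T, ‖c k‖ = 1 := fun k hk => by simpa using hKT (hT k hk).1
  obtain ⟨d, hdT, hd⟩ : ∃ d, (∀ k ∈ T, d < δ k) ∧ 0 < d :=
    (((Filter.eventually_all_finset T).2 fun k hk =>
      (eventually_lt_nhds (hT k hk).2).filter_mono nhdsWithin_le_nhds).and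
        (eventually_mem_nhdsWithin (a := (0 : ℝ)) (s := Set.Ioi 0))).exists
  set w : ℕ → ℂ → ℂ := fun k z => 1 + δ k - z * (starRingEnd ℂ) (c k)
  have hw : ∀ k ∈ T, ∀ z ∈ Metric.ball (0 : ℂ) (1 + d), 0 < (w k z).re := fun k hk z hz => by
    have h1 : (z * (starRingEnd ℂ) (c k)).re ≤ ‖z‖ := by
      refine (Complex.re_le_norm _).trans_eq ?_
      rw [norm_mul, RCLike.norm_conj, hc k hk, mul_one]
    have h2 : ‖z‖ < 1 + d := by simpa using hz
    have h3 := hdT k hk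
    simp only [w, Complex.sub_re, Complex.add_re, Complex.one_re, Complex.ofReal_re]
    linarith
  have hterm : ∀ k z, ((δ k : ℂ) / w k z).re = δ k * ((w k z).re / Complex.normSq (w k z)) :=
    fun k z => by rw [div_eq_mul_inv, Complex.re_ofReal_mul, Complex.inv_re]
  have hpos : ∀ k ∈ T, ∀ z ∈ Metric.ball (0 : ℂ) (1 + d), 0 ≤ ((δ k : ℂ) / w k z).re :=
    fun k hk z hz => by
      rw [hterm]
      exact mul_nonneg (hT k hk).2.le (div_nonneg (hw k hk z hz).le (Complex.normSq_nonneg _))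
  set u : ℂ → ℂ := fun z => A * ∑ k ∈ T, (δ k : ℂ) / w k z
  have hu_re : ∀ z, (u z).re = A * ∑ k ∈ T, ((δ k : ℂ) / w k z).re := fun z => by
    simp only [u, Complex.re_ofReal_mul, Complex.re_sum]
  have hu : ∀ z ∈ Metric.ball (0 : ℂ) (1 + d), 0 ≤ (u z).re := fun z hz => by
    rw [hu_re]
    exact mul_nonneg hA0.le (Finset.sum_nonneg fun k hk => hpos k hk z hz)
  have hu1 : ∀ z ∈ Metric.ball (0 : ℂ) (1 + d), 1 + u z ≠ 0 := fun z hz h => by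
    have h1 := congrArg Complex.re h
    have h2 := hu z hz
    simp only [Complex.add_re, Complex.one_re, Complex.zero_re] at h1
    linarith
  have hud : DifferentiableOn ℂ u (Metric.ball 0 (1 + d)) := by
    refine DifferentiableOn.const_mul (DifferentiableOn.fun_sum fun k hk => ?_) _
    refine DifferentiableOn.div (differentiableOn_const _) (by fun_prop) fun z hz h => ?_
    have := hw k hk z hz
    simp [w, h] at this
  refine ⟨1 + d, fun z => u z / (1 + u z), by linarith, hud.div (hud.const_add 1) hu1, ?_, ?_, ?_⟩
  · intro z hz
    have h1 : 0 < Complex.normSq (1 + u z) := Complex.normSq_pos.2 (hu1 z hz)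
    rw [← Complex.normSq_eq_norm_sq, Complex.normSq_div, Complex.div_re, ← add_div]
    gcongr
    simp only [Complex.normSq_apply, Complex.add_re, Complex.add_im, Complex.one_re, Complex.one_im]
    nlinarith [hu z hz]
  · have hz : (0 : ℂ) ∈ Metric.ball (0 : ℂ) (1 + d) := by simp; linarith
    have h1 : ‖u 0‖ ≤ η := by
      calc ‖u 0‖ ≤ A * ∑ k ∈ T, δ k := by
            simp only [u, norm_mul, Complex.norm_real, Real.norm_of_nonneg hA0.le]
            refine mul_le_mul_of_nonneg_left ((norm_sum_le _ _).trans
              (Finset.sum_le_sum fun k hk => ?_)) hA0.le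
            have h2 := (hT k hk).2
            have h3 : w k 0 = ((1 + δ k : ℝ) : ℂ) := by simp [w]
            rw [h3, ← Complex.ofReal_div, Complex.norm_real, Real.norm_of_nonneg (by positivity)]
            exact div_le_self h2.le (by linarith)
        _ ≤ A * (η / A) := mul_le_mul_of_nonneg_left hsum.le hA0.le
        _ = η := mul_div_cancel₀ _ hA0.ne'
    refine (Complex.re_le_norm _).trans ?_
    rw [norm_div]
    refine (div_le_self (norm_nonneg _) ?_).trans h1
    have h4 := Complex.re_le_norm (1 + u 0)
    have h5 := hu 0 hz
    simp only [Complex.add_re, Complex.one_re] at h4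
    linarith
  · intro ζ hζ
    have hζ1 : ‖ζ‖ = 1 := by simpa using hKT hζ
    have hz : ζ ∈ Metric.ball (0 : ℂ) (1 + d) := by rw [mem_ball_zero_iff, hζ1]; linarith
    obtain ⟨k, hk, hkζ⟩ := hcov ζ hζ
    have hδ := (hT k hk).2
    have hw1 : ‖w k ζ - δ k‖ ≤ δ k := by
      have h1 : w k ζ - δ k = (c k - ζ) * (starRingEnd ℂ) (c k) := by
        rw [sub_mul, Complex.mul_conj, Complex.normSq_eq_norm_sq, hc k hk]
        simp only [w]
        push_cast
        ring
      rw [h1, norm_mul, RCLike.norm_conj, hc k hk, mul_one, ← dist_eq_norm, dist_comm]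
      exact hkζ.le
    have hquarter : 1 / 4 ≤ ((δ k : ℂ) / w k ζ).re := by
      have h1 : 0 < Complex.normSq (w k ζ) := Complex.normSq_pos.2 fun h => by
        have := hw k hk ζ hz
        simp [h] at this
      have h2 : Complex.normSq (w k ζ - δ k) ≤ δ k ^ 2 := by
        rw [Complex.normSq_eq_norm_sq]
        gcongr
      have h3 : (w k ζ).re ≤ 2 * δ k := by
        have := (Complex.re_le_norm _).trans hw1
        simp only [Complex.sub_re, Complex.ofReal_re] at this
        linarith
      rw [hterm, mul_div_assoc', le_div_iff₀ h1]
      simp only [Complex.normSq_apply, Complex.sub_re, Complex.sub_im, Complex.ofReal_re,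
        Complex.ofReal_im] at h2 ⊢
      nlinarith [hw k hk ζ hz]
    have hure : 1 / κ ≤ (u ζ).re := by
      rw [hu_re]
      calc 1 / κ = A * (1 / 4) := by rw [hA]; ring
        _ ≤ A * ((δ k : ℂ) / w k ζ).re := by gcongr
        _ ≤ _ := mul_le_mul_of_nonneg_left
          (Finset.single_le_sum (fun i hi => hpos i hi ζ hz) hk) hA0.le
    have h1 : u ζ / (1 + u ζ) - 1 = -(1 + u ζ)⁻¹ := by
      field_simp [hu1 ζ hz]
      ring
    rw [h1, norm_neg, norm_inv]
    refine inv_le_of_inv_le₀ hκ ?_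
    have h4 := Complex.re_le_norm (1 + u ζ)
    simp only [Complex.add_re, Complex.one_re, one_div] at h4 hure
    linarith

theorem exists_small_hardyNorm_iteratedDeriv_near {p : ℝ} (hp : 1 ≤ p) {K : Set ℂ}
    (hK : IsCompact K) (hKT : K ⊆ Metric.sphere (0 : ℂ) 1)
    (h0 : Measure.hausdorffMeasure 1 K = 0) {Q : ℂ → ℂ} (hQ : Differentiable ℂ Q) (l : ℕ)
    {ε κ : ℝ} (hε : 0 < ε) (hκ : 0 < κ) :
    ∃ F : ℂ → ℂ, MemHp p F ∧ hardyNorm p F < ε ∧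
      ContinuousOn (iteratedDeriv l F) (Metric.closedBall 0 1) ∧
      ∀ ζ ∈ K, ‖iteratedDeriv l F ζ - Q ζ‖ ≤ κ := by
  obtain ⟨C, hC⟩ := (isCompact_closedBall (0 : ℂ) 1).exists_bound_of_continuousOn
    hQ.continuous.continuousOn
  set M : ℝ := max C 1
  have hM1 : 1 ≤ M := le_max_right _ _
  have hM0 : 0 < M := one_pos.trans_le hM1
  have hQM : ∀ z ∈ Metric.closedBall (0 : ℂ) 1, ‖Q z‖ ≤ M := fun z hz =>
    (hC z hz).trans (le_max_left _ _)
  have hp0 : 0 < p := one_pos.trans_le hp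
  set ε' : ℝ := ε / 2
  have hε' : 0 < ε' := by positivity
  obtain ⟨R, g, hR, hg, hgre, hg0, hgK⟩ := exists_holomorphic_peak hK hKT h0
    (η := (ε' / M) ^ p) (κ := κ / (2 * M)) (by positivity) (by positivity)
  have hsub : Metric.closedBall (0 : ℂ) 1 ⊆ Metric.ball 0 R := Metric.closedBall_subset_ball hR
  have hg1 : ∀ z ∈ Metric.ball (0 : ℂ) R, ‖g z‖ ≤ 1 := fun z hz => by
    have h1 := hgre z hz
    have h2 := Complex.re_le_norm (g z)
    nlinarith [norm_nonneg (g z)]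
  have hf : DifferentiableOn ℂ (fun z => g z ^ 2 * Q z) (Metric.ball 0 R) :=
    (hg.pow 2).mul hQ.differentiableOn
  have hfM : ∀ z ∈ Metric.ball (0 : ℂ) 1, ‖g z ^ 2 * Q z‖ ≤ M := fun z hz => by
    have hz' := Metric.ball_subset_closedBall hz
    rw [norm_mul, norm_pow]
    exact (mul_le_of_le_one_left (norm_nonneg _)
      (pow_le_one₀ (norm_nonneg _) (hg1 z (hsub hz')))).trans (hQM z hz')
  have hfre : ∀ z ∈ Metric.ball (0 : ℂ) 1, ‖g z ^ 2 * Q z‖ ≤ ((M : ℂ) * g z).re := fun z hz => by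
    have hz' := Metric.ball_subset_closedBall hz
    rw [norm_mul, norm_pow, Complex.re_ofReal_mul, mul_comm M]
    exact mul_le_mul (hgre z (hsub hz')) (hQM z hz') (norm_nonneg _)
      ((by positivity : (0 : ℝ) ≤ ‖g z‖ ^ 2).trans (hgre z (hsub hz')))
  obtain ⟨F, H, hFf, hFd, hHd, hH0, hFM, hFH⟩ := exists_iteratedDeriv_eqOn_le_re hR.le l hf
    ((hg.const_mul (M : ℂ)).mono (Metric.ball_subset_closedBall.trans hsub)) hfM hfre
  have hFd1 := hFd.mono (Metric.ball_subset_closedBall.trans hsub)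
  have hmean := hardyMean_le hp hFd1 hHd hFM hFH
  have hbound : (M ^ (p - 1) * (H 0).re) ^ (1 / p) ≤ ε' := by
    rw [hH0, Complex.re_ofReal_mul, ← mul_assoc, ← Real.rpow_add_one hM0.ne', sub_add_cancel,
      one_div]
    have h1 : 0 ≤ (g 0).re := (by positivity : (0 : ℝ) ≤ ‖g 0‖ ^ 2).trans
      (hgre 0 (hsub (by simp)))
    rw [Real.rpow_inv_le_iff_of_pos (by positivity) hε'.le hp0]
    calc M ^ p * (g 0).re ≤ M ^ p * (ε' / M) ^ p := by gcongr
      _ = ε' ^ p := by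
        rw [← Real.mul_rpow hM0.le (by positivity), mul_div_cancel₀ _ hM0.ne']
  refine ⟨F, ⟨hFd1, ⟨_, Set.forall_mem_range.2 hmean⟩⟩, ?_, ?_, ?_⟩
  · have : Nonempty (Set.Ioo (0 : ℝ) 1) := ⟨⟨1 / 2, by norm_num, by norm_num⟩⟩
    exact (ciSup_le fun r => (hmean r).trans hbound).trans_lt (half_lt_self hε)
  · exact (hf.continuousOn.congr hFf).mono hsub
  · intro ζ hζ
    have hζ1 : ζ ∈ Metric.closedBall (0 : ℂ) 1 := Metric.sphere_subset_closedBall (hKT hζ)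
    rw [hFf (hsub hζ1)]
    have h1 : g ζ ^ 2 * Q ζ - Q ζ = (g ζ - 1) * (g ζ + 1) * Q ζ := by ring
    have h2 : ‖g ζ + 1‖ ≤ 2 := by
      have := norm_add_le (g ζ) 1
      rw [norm_one] at this
      linarith [hg1 ζ (hsub hζ1)]
    rw [h1, norm_mul, norm_mul]
    calc ‖g ζ - 1‖ * ‖g ζ + 1‖ * ‖Q ζ‖ ≤ κ / (2 * M) * 2 * M := by
          gcongr
          exacts [hgK ζ hζ, hQM ζ hζ1]
      _ = κ := by field_simp

/-- Lemma (hardyderdense1): `⋃_{r∈ρ} U(j,s,l,r)` intersects every neighbourhood of `0` in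
`H^p(𝔻)`: for every `ε > 0` there are `r ∈ ρ` and `f ∈ U(j,s,l,r)` with `‖f‖_{H^p} < ε`. -/
theorem statement_13 (p : ℝ) (hp : 1 ≤ p)
    (ρ : Set ℝ) (hρ : ρ ⊆ Set.Ico (0:ℝ) 1) (hρ1 : AccPt (1:ℝ) (Filter.principal ρ))
    (K : Set ℂ) (hKc : IsCompact K) (hKT : K ⊆ Metric.sphere (0:ℂ) 1)
    (hKm : arcMeasure K = 0)
    (P : ℕ → Polynomial ℂ) (hP1 : ∀ j, RatPoly (P j))
    (hP2 : ∀ q : Polynomial ℂ, RatPoly q → ∃ j, P j = q)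
    (j l s : ℕ) (hs : 1 ≤ s) (ε : ℝ) (hε : 0 < ε) :
    ∃ r ∈ ρ, ∃ f : HpSpace p, f ∈ UHpD p K P j s l r ∧ hardyNorm p f.1 < ε := by
  obtain ⟨F, hFH, hFε, hFc, hFK⟩ := exists_small_hardyNorm_iteratedDeriv_near hp hKc hKT
    (hausdorffMeasure_eq_zero_of_arcMeasure_eq_zero hKT hKm) (P j).differentiable l hε
    (κ := 1 / (4 * (s : ℝ))) (by positivity)
  have hs0 : (0 : ℝ) < s := by exact_mod_cast hs
  have huc := (isCompact_closedBall (0 : ℂ) 1).uniformContinuousOn_of_continuous hFc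
  obtain ⟨d, hd, hdF⟩ := Metric.uniformContinuousOn_iff.1 huc (1 / (4 * (s : ℝ))) (by positivity)
  obtain ⟨r, ⟨hr1, hrρ⟩, hrd⟩ := ((accPt_iff_frequently.1 hρ1).and_eventually
    (Metric.ball_mem_nhds (1 : ℝ) (half_pos hd))).exists
  have hr := hρ hrρ
  refine ⟨r, hrρ, ⟨F, hFH⟩, ?_, hFε⟩
  refine lt_of_le_of_lt (b := 1 / (2 * (s : ℝ))) ?_
    (one_div_lt_one_div_of_lt hs0 (by linarith))
  refine Real.iSup_le (fun ζ => Real.iSup_le (fun hζ => Real.iSup_le (fun z =>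
    Real.iSup_le (fun hz => ?_) (by positivity)) (by positivity)) (by positivity)) (by positivity)
  have hζ1 : ‖ζ‖ = 1 := by simpa using hKT hζ
  have hz1 : ‖z‖ ≤ 1 := (mem_closedBall_zero_iff.1 hz).trans
    ((div_le_one (by positivity)).2 (by linarith))
  have hmem : (r : ℂ) * (ζ - z) + z ∈ Metric.closedBall (0 : ℂ) 1 := by
    have h1 : (r : ℂ) * (ζ - z) + z = (r : ℂ) * ζ + ((1 - r : ℝ) : ℂ) * z := by push_cast; ring
    rw [mem_closedBall_zero_iff, h1]
    refine (norm_add_le _ _).trans ?_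
    rw [norm_mul, norm_mul, Complex.norm_real, Complex.norm_real, Real.norm_of_nonneg hr.1,
      Real.norm_of_nonneg (sub_nonneg.2 hr.2.le), hζ1]
    nlinarith [hr.2]
  have hdist : dist ((r : ℂ) * (ζ - z) + z) ζ < d := by
    have h1 : (r : ℂ) * (ζ - z) + z - ζ = ((1 - r : ℝ) : ℂ) * (z - ζ) := by push_cast; ring
    have h2 : ‖z - ζ‖ ≤ 2 := (norm_sub_le _ _).trans (by linarith)
    have h3 : 1 - r < d / 2 := by
      have := abs_lt.1 (Metric.mem_ball.1 hrd)
      linarith [this.1]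
    rw [dist_eq_norm, h1, norm_mul, Complex.norm_real, Real.norm_of_nonneg (sub_nonneg.2 hr.2.le)]
    nlinarith [hr.2]
  have h1 := hdF _ hmem ζ (Metric.sphere_subset_closedBall (hKT hζ)) hdist
  rw [dist_eq_norm] at h1
  calc ‖iteratedDeriv l F ((r : ℂ) * (ζ - z) + z) - (P j).eval ζ‖
      ≤ ‖iteratedDeriv l F ((r : ℂ) * (ζ - z) + z) - iteratedDeriv l F ζ‖ +
          ‖iteratedDeriv l F ζ - (P j).eval ζ‖ := norm_sub_le_norm_sub_add_norm_sub _ _ _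
    _ ≤ 1 / (4 * (s : ℝ)) + 1 / (4 * (s : ℝ)) := add_le_add h1.le (hFK ζ hζ)
    _ = 1 / (2 * (s : ℝ)) := by field_simp; norm_num
end
end

section
/- Let 1 ≤ p < ∞, let ρ ⊆ [0,1) have 1 as a limit point, and let K ⊆ 𝕋 be compact with m(K) = 0. For every j, l ∈ ℕ and s ∈ ℕ*, the set ⋃_{r∈ρ} U(j,s,l,r) is dense in H^p(𝔻). -/
open Complex Metric Set Filter MeasureTheory Polynomial Topology

noncomputable section

/-- The `p`-th power mean `(1/2π) ∫ ‖F (e^{iθ})‖ ^ p dθ` over the unit circle. -/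
def circleMeanPow (p : ℝ) (F : ℂ → ℂ) : ℝ :=
  Real.circleAverage (fun z => ‖F z‖ ^ p) 0 1

lemma circleIntegrable_of_continuousOn_sphere {E : Type*} [NormedAddCommGroup E]
    {F : ℂ → E} (hF : ContinuousOn F (sphere 0 1)) : CircleIntegrable F 0 1 :=
  ContinuousOn.circleIntegrable zero_le_one hF

lemma continuousOn_norm_rpow {p : ℝ} (hp : 0 ≤ p) {F : ℂ → ℂ} {S : Set ℂ}
    (hF : ContinuousOn F S) : ContinuousOn (fun z => ‖F z‖ ^ p) S :=
  hF.norm.rpow_const fun _ _ => Or.inr hp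

lemma circleIntegrable_norm_rpow {p : ℝ} (hp : 0 ≤ p) {F : ℂ → ℂ}
    (hF : ContinuousOn F (sphere 0 1)) : CircleIntegrable (fun z => ‖F z‖ ^ p) 0 1 :=
  circleIntegrable_of_continuousOn_sphere (continuousOn_norm_rpow hp hF)

lemma circleAverage_unit_mono {u v : ℂ → ℝ} (hu : ContinuousOn u (sphere 0 1))
    (hv : ContinuousOn v (sphere 0 1)) (h : ∀ z ∈ sphere (0 : ℂ) 1, u z ≤ v z) :
    Real.circleAverage u 0 1 ≤ Real.circleAverage v 0 1 :=
  Real.circleAverage_mono (circleIntegrable_of_continuousOn_sphere hu)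
    (circleIntegrable_of_continuousOn_sphere hv) (by simpa using h)

lemma circleMeanPow_nonneg (p : ℝ) (F : ℂ → ℂ) : 0 ≤ circleMeanPow p F :=
  Real.circleAverage_nonneg_of_nonneg fun _ _ => by positivity

lemma circleMeanPow_le_of_norm_le {p : ℝ} (hp : 0 ≤ p) {F : ℂ → ℂ} {c : ℝ}
    (hF : ContinuousOn F (sphere 0 1)) (h : ∀ z ∈ sphere (0 : ℂ) 1, ‖F z‖ ≤ c) :
    circleMeanPow p F ≤ c ^ p :=
  Real.circleAverage_mono_on_of_le_circle (circleIntegrable_norm_rpow hp hF) fun z hz =>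
    Real.rpow_le_rpow (norm_nonneg _) (h z (by simpa using hz)) hp

lemma circleAverage_unit_rotate {E : Type*} [NormedAddCommGroup E] [NormedSpace ℝ E]
    (u : ℂ → E) (η : ℝ) :
    Real.circleAverage (fun z => u (circleMap 0 1 η * z)) 0 1 = Real.circleAverage u 0 1 := by
  rw [Real.circleAverage_eq_integral_add (f := u) η, Real.circleAverage_def]
  congr 2
  ext θ
  congr 1
  simp [circleMap, add_mul, Complex.exp_add, mul_comm (cexp (η * I))]

lemma circleAverage_swap {F : ℂ → ℂ → ℝ}
    (hF : Continuous fun x : ℝ × ℝ => F (circleMap 0 1 x.1) (circleMap 0 1 x.2)) :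
    Real.circleAverage (fun z => Real.circleAverage (fun w => F z w) 0 1) 0 1 =
      Real.circleAverage (fun w => Real.circleAverage (fun z => F z w) 0 1) 0 1 := by
  simp only [Real.circleAverage_def, intervalIntegral.integral_smul]
  rw [intervalIntegral_intervalIntegral_swap]
  exact (hF.continuousOn.integrableOn_compact (isCompact_uIcc.prod isCompact_uIcc)).mono_set
    (Set.prod_mono uIoc_subset_uIcc uIoc_subset_uIcc)

lemma le_circleAverage_rpow {p : ℝ} (hp : 1 ≤ p) {W u : ℂ → ℝ}
    (hW : ContinuousOn W (sphere 0 1)) (hW0 : ∀ z ∈ sphere (0 : ℂ) 1, 0 ≤ W z)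
    (hW1 : Real.circleAverage W 0 1 = 1)
    (hu : ContinuousOn u (sphere 0 1)) (hu0 : ∀ z ∈ sphere (0 : ℂ) 1, 0 ≤ u z)
    {y : ℝ} (hy0 : 0 ≤ y) (hy : y ≤ Real.circleAverage (fun z => W z * u z) 0 1) :
    y ^ p ≤ Real.circleAverage (fun z => W z * u z ^ p) 0 1 := by
  have hp0 : 0 < p := by linarith
  rcases hy0.eq_or_lt with rfl | hy0
  · rw [Real.zero_rpow hp0.ne']
    exact Real.circleAverage_nonneg_of_nonneg fun z hz =>
      mul_nonneg (hW0 z (by simpa using hz)) (Real.rpow_nonneg (hu0 z (by simpa using hz)) p)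
  have key : ∀ x : ℝ, 0 ≤ x → y ^ p * (1 - p) + y ^ p * p / y * x ≤ x ^ p := by
    intro x hx
    have h := one_add_mul_self_le_rpow_one_add (s := x / y - 1)
      (by linarith [div_nonneg hx hy0.le]) hp
    have h2 := mul_le_mul_of_nonneg_left h (Real.rpow_nonneg hy0.le p)
    rw [add_sub_cancel, ← Real.mul_rpow hy0.le (by positivity), mul_div_cancel₀ x hy0.ne'] at h2
    calc _ = y ^ p * (1 + p * (x / y - 1)) := by ring
      _ ≤ _ := h2
  have hup : ContinuousOn (fun z => u z ^ p) (sphere 0 1) :=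
    hu.rpow_const fun _ _ => Or.inr hp0.le
  have h1 : Real.circleAverage (fun z => y ^ p * (1 - p) * W z + y ^ p * p / y * (W z * u z)) 0 1
      ≤ Real.circleAverage (fun z => W z * u z ^ p) 0 1 := by
    refine circleAverage_unit_mono (by fun_prop) (by fun_prop) fun z hz => ?_
    have := mul_le_mul_of_nonneg_left (key _ (hu0 z hz)) (hW0 z hz)
    linarith
  have h2 : Real.circleAverage
      (fun z => y ^ p * (1 - p) * W z + y ^ p * p / y * (W z * u z)) 0 1
      = y ^ p * (1 - p) + y ^ p * p / y * Real.circleAverage (fun z => W z * u z) 0 1 := by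
    have := Real.circleAverage_fun_add (c := 0) (R := 1) (f₁ := fun z => y ^ p * (1 - p) * W z)
      (f₂ := fun z => y ^ p * p / y * (W z * u z))
      (circleIntegrable_of_continuousOn_sphere (by fun_prop))
      (circleIntegrable_of_continuousOn_sphere (by fun_prop))
    rw [this]
    have e1 := Real.circleAverage_fun_smul (a := y ^ p * (1 - p)) (f := W) (c := 0) (R := 1)
    have e2 := Real.circleAverage_fun_smul (a := y ^ p * p / y) (f := fun z => W z * u z)
      (c := 0) (R := 1)
    simp only [smul_eq_mul] at e1 e2
    rw [e1, e2, hW1, mul_one]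
  have h3 : y ^ p * p / y * y ≤ y ^ p * p / y * Real.circleAverage (fun z => W z * u z) 0 1 :=
    mul_le_mul_of_nonneg_left hy (by positivity)
  rw [div_mul_cancel₀ _ hy0.ne'] at h3
  linarith

lemma circleMeanPow_dilate_le {p : ℝ} (hp : 1 ≤ p) {F : ℂ → ℂ}
    (hF : DiffContOnCl ℂ F (ball 0 1)) {t : ℝ} (ht0 : 0 ≤ t) (ht1 : t < 1) :
    circleMeanPow p (fun z => F (t * z)) ≤ circleMeanPow p F := by
  have hp0 : 0 ≤ p := by linarith
  have htb : (t : ℂ) ∈ ball (0 : ℂ) 1 := by simpa [abs_of_nonneg ht0] using ht1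
  have hFc : ContinuousOn F (closedBall 0 1) := by
    simpa [closure_ball] using hF.continuousOn
  set W : ℂ → ℝ := poissonKernel 0 t with hWdef
  have hne : ∀ z ∈ sphere (0 : ℂ) 1, z - t ≠ 0 := by
    rintro z hz h
    rw [sub_eq_zero.1 h] at hz
    simp [abs_of_nonneg ht0] at hz
    linarith
  have hW : ContinuousOn W (sphere 0 1) := by
    refine ContinuousOn.div (by fun_prop) (by fun_prop) fun z hz => ?_
    simpa using hne z hz
  have hW0 : ∀ z ∈ sphere (0 : ℂ) 1, 0 ≤ W z := by
    intro z hz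
    have hz : ‖z‖ = 1 := by simpa using hz
    refine div_nonneg ?_ (by positivity)
    simpa [hz, abs_of_nonneg ht0] using ht1.le
  have hW1 : Real.circleAverage W 0 1 = 1 := by
    have h1 := DiffContOnCl.circleAverage_poissonKernel_smul (f := fun _ => (1 : ℂ))
      diffContOnCl_const htb
    have h2 := Complex.reCLM.circleAverage_comp_comm (f := W • fun _ => (1 : ℂ)) (c := 0) (R := 1)
      (circleIntegrable_of_continuousOn_sphere (hW.smul continuousOn_const))
    rw [h1] at h2
    simpa [Function.comp_def] using h2
  have hmul : ∀ z ∈ closedBall (0 : ℂ) 1, ∀ w ∈ closedBall (0 : ℂ) 1,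
      z * w ∈ closedBall (0 : ℂ) 1 := by
    intro z hz w hw
    simp only [mem_closedBall_zero_iff, norm_mul] at *
    exact mul_le_one₀ hz (norm_nonneg _) hw
  have hrot : ∀ z ∈ sphere (0 : ℂ) 1, DiffContOnCl ℂ (fun w => F (z * w)) (ball 0 1) := by
    intro z hz
    have hz : ‖z‖ = 1 := by simpa using hz
    refine hF.comp (DifferentiableOn.diffContOnCl (by fun_prop)) ?_
    intro w hw
    simpa [hz] using hw
  have hcirc : ∀ θ : ℝ, circleMap 0 1 θ ∈ sphere (0 : ℂ) 1 := fun θ => by simp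
  have hpt : ∀ z ∈ sphere (0 : ℂ) 1,
      ‖F (t * z)‖ ^ p ≤ Real.circleAverage (fun w => W w * ‖F (z * w)‖ ^ p) 0 1 := by
    intro z hz
    have hzc := (hrot z hz).continuousOn
    rw [closure_ball _ one_ne_zero] at hzc
    have hzc := hzc.mono sphere_subset_closedBall
    refine le_circleAverage_rpow hp hW hW0 hW1 hzc.norm (fun _ _ => norm_nonneg _)
      (norm_nonneg _) ?_
    have := (hrot z hz).circleAverage_poissonKernel_smul htb
    rw [mul_comm, ← this]
    simp only [Real.circleAverage_def, norm_smul]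
    rw [Real.norm_of_nonneg (by positivity), smul_eq_mul]
    refine mul_le_mul_of_nonneg_left ?_ (by positivity)
    refine (intervalIntegral.norm_integral_le_integral_norm (by positivity)).trans_eq ?_
    refine intervalIntegral.integral_congr fun θ _ => ?_
    simp [abs_of_nonneg (hW0 _ (hcirc θ)), ← hWdef]
  have hcont : Continuous fun x : ℝ × ℝ =>
      W (circleMap 0 1 x.2) * ‖F (circleMap 0 1 x.1 * circleMap 0 1 x.2)‖ ^ p := by
    refine Continuous.mul ?_ ?_
    · exact hW.comp_continuous (by fun_prop) fun x => hcirc _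
    · refine Continuous.rpow_const (Continuous.norm ?_) fun _ => Or.inr hp0
      exact hFc.comp_continuous (by fun_prop) fun x =>
        hmul _ (sphere_subset_closedBall (hcirc _)) _ (sphere_subset_closedBall (hcirc _))
  calc circleMeanPow p (fun z => F (t * z))
      ≤ Real.circleAverage (fun z => Real.circleAverage (fun w => W w * ‖F (z * w)‖ ^ p) 0 1) 0 1 := by
        refine Real.circleAverage_mono ?_ ?_ (by simpa using hpt)
        · exact circleIntegrable_norm_rpow hp0 <| hFc.comp (by fun_prop) fun z hz =>
            hmul _ (ball_subset_closedBall htb) _ (sphere_subset_closedBall hz)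
        · refine Continuous.intervalIntegrable ?_ _ _
          have := intervalIntegral.continuous_parametric_intervalIntegral_of_continuous'
            (μ := volume) (f := fun x y : ℝ =>
              W (circleMap 0 1 y) * ‖F (circleMap 0 1 x * circleMap 0 1 y)‖ ^ p)
            hcont 0 (2 * Real.pi)
          simp only [Real.circleAverage_def, smul_eq_mul]
          exact continuous_const.mul this
    _ = Real.circleAverage (fun w => Real.circleAverage (fun z => W w * ‖F (z * w)‖ ^ p) 0 1) 0 1 :=
        circleAverage_swap (F := fun z w => W w * ‖F (z * w)‖ ^ p) hcont
    _ = Real.circleAverage (fun w => circleMeanPow p F * W w) 0 1 := by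
        simp only [Real.circleAverage_def (c := 0)]
        congr 2
        ext θ
        have h1 := Real.circleAverage_fun_smul (a := W (circleMap 0 1 θ))
          (f := fun z => ‖F (z * circleMap 0 1 θ)‖ ^ p) (c := 0) (R := 1)
        have h2 := circleAverage_unit_rotate (fun z => ‖F z‖ ^ p) θ
        simp only [mul_comm (circleMap 0 1 θ)] at h2
        rw [h2, smul_eq_mul, Real.circleAverage_def] at h1
        simpa [circleMeanPow, mul_comm] using h1
    _ = circleMeanPow p F := by
        have := Real.circleAverage_fun_smul (a := circleMeanPow p F) (f := W) (c := 0) (R := 1)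
        simpa [hW1] using this

lemma exists_polynomial_approx {R : ℝ} (hR : 1 < R) {F : ℂ → ℂ}
    (hF : DifferentiableOn ℂ F (ball 0 R)) {ε : ℝ} (hε : 0 < ε) :
    ∃ q : ℂ[X], ∀ z ∈ closedBall (0 : ℂ) 1, ‖F z - q.eval z‖ < ε := by
  obtain ⟨a, ha1, haR⟩ := exists_between hR
  obtain ⟨b, hb1, hba⟩ := exists_between ha1
  lift a to NNReal using by linarith
  lift b to NNReal using by linarith
  have hps := DifferentiableOn.hasFPowerSeriesOnBall (R := a) (c := 0) (f := F)
    (hF.mono (closedBall_subset_ball haR)) (by exact_mod_cast zero_lt_one.trans ha1)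
  have := hps.tendstoUniformlyOn (r' := b) (by exact_mod_cast hba)
  rw [Metric.tendstoUniformlyOn_iff] at this
  obtain ⟨n, hn⟩ := (this ε hε).exists
  refine ⟨∑ k ∈ Finset.range n, Polynomial.monomial k ((cauchyPowerSeries F 0 a).coeff k), ?_⟩
  intro z hz
  have := hn z (closedBall_subset_ball hb1 hz)
  rw [dist_eq_norm, zero_add] at this
  have hq : (∑ k ∈ Finset.range n,
      Polynomial.monomial k ((cauchyPowerSeries F 0 a).coeff k)).eval z =
      (cauchyPowerSeries F 0 a).partialSum n z := by
    simp [FormalMultilinearSeries.partialSum, Polynomial.eval_finsetSum,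
      mul_comm]
  rwa [hq]

lemma circleAverage_inv_pow_mul_dilate {g : ℂ → ℂ} (hg : DiffContOnCl ℂ g (ball 0 1))
    {t : ℝ} (ht0 : 0 < t) (ht1 : t ≤ 1) (n : ℕ) :
    Real.circleAverage (fun z => z⁻¹ ^ n * g (t * z)) 0 1 =
      t ^ n * Real.circleAverage (fun z => z⁻¹ ^ n * g z) 0 1 := by
  have hgc : ContinuousOn g (closedBall 0 1) := by
    simpa [closure_ball] using hg.continuousOn
  have h1 : Real.circleAverage (fun z => z⁻¹ ^ n * g z) 0 1 =
      Real.circleAverage (fun z => z⁻¹ ^ n * g z) 0 t := by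
    rw [Real.circleAverage_eq_circleIntegral one_ne_zero,
      Real.circleAverage_eq_circleIntegral ht0.ne']
    congr 1
    refine circleIntegral_sub_center_inv_smul_eq_of_differentiable_on_annulus_off_countable
      ht0 ht1 countable_empty ?_ ?_
    · refine ContinuousOn.mul ?_ (hgc.mono sdiff_subset)
      refine ContinuousOn.pow (continuousOn_inv₀.mono fun z hz h => hz.2 ?_) n
      rw [show z = 0 from h]
      exact mem_ball_self ht0
    · rintro z ⟨hz, -⟩
      have hz0 : z ≠ 0 := by
        rintro rfl
        exact hz.2 (mem_closedBall_self ht0.le)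
      exact ((differentiableAt_inv hz0).pow n).mul (hg.differentiableAt isOpen_ball hz.1)
  have h2 : Real.circleAverage (fun z => z⁻¹ ^ n * g z) 0 t =
      Real.circleAverage (fun z => ((t : ℂ)⁻¹ ^ n) • (z⁻¹ ^ n * g (t * z))) 0 1 := by
    rw [Real.circleAverage_eq_circleAverage_zero_one]
    congr 1
    ext z
    simp only [add_zero, mul_inv, mul_pow, smul_eq_mul]
    ring
  rw [h1, h2, Real.circleAverage_fun_smul, smul_eq_mul, ← mul_assoc, ← mul_pow,
    mul_inv_cancel₀ (by exact_mod_cast ht0.ne'), one_pow, one_mul]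

lemma hasSum_circleAverage_inv_pow_mul {g : ℂ → ℂ} (hg : DiffContOnCl ℂ g (ball 0 1))
    {w : ℂ} (hw : ‖w‖ < 1) :
    HasSum (fun n : ℕ => w ^ n * Real.circleAverage (fun z => z⁻¹ ^ n * g z) 0 1) (g w) := by
  have hps := DiffContOnCl.hasFPowerSeriesOnBall (R := 1) (by simpa using hg) one_pos
  have h := hps.hasSum (y := w) (by
    rw [Metric.mem_eball, edist_zero_right, ← ofReal_norm, ENNReal.coe_one, ENNReal.ofReal_lt_one]
    exact hw)
  rw [zero_add] at h
  have hterm : (fun n : ℕ => w ^ n * Real.circleAverage (fun z => z⁻¹ ^ n * g z) 0 1) =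
      fun n => (cauchyPowerSeries g 0 (1 : NNReal) n) fun _ => w := by
    ext n
    rw [cauchyPowerSeries_apply, NNReal.coe_one, ← smul_eq_mul, ← Real.circleAverage_fun_smul,
      Real.circleAverage_eq_circleIntegral one_ne_zero]
    congr 1
    refine circleIntegral.integral_congr zero_le_one fun z _ => ?_
    simp only [sub_zero, smul_eq_mul, div_eq_mul_inv, mul_pow]
    ring
  rwa [hterm]

lemma re_circleAverage_sub_dilate_mul_conj_nonneg {g : ℂ → ℂ}
    (hg : DiffContOnCl ℂ g (ball 0 1)) {t : ℝ} (ht0 : 0 < t) (ht1 : t < 1) :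
    0 ≤ (Real.circleAverage
      (fun z => (g z - g (t * z)) * (starRingEnd ℂ) (g (t * z))) 0 1).re := by
  have hgc : ContinuousOn g (closedBall 0 1) := by
    simpa [closure_ball] using hg.continuousOn
  have hmaps : MapsTo (fun z : ℂ => t * z) (sphere 0 1) (closedBall 0 1) := by
    intro z hz
    have hz : ‖z‖ = 1 := by simpa using hz
    simp [hz, abs_of_pos ht0, ht1.le]
  have hgs : ContinuousOn g (sphere 0 1) := hgc.mono sphere_subset_closedBall
  have hgt : ContinuousOn (fun z => g (t * z)) (sphere 0 1) := hgc.comp (by fun_prop) hmaps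
  obtain ⟨B, hB⟩ := (isCompact_closedBall (0 : ℂ) 1).exists_bound_of_continuousOn hgc
  have hB0 : 0 ≤ B := (norm_nonneg _).trans (hB 0 (by simp))
  set a : ℕ → ℂ := fun n => Real.circleAverage (fun z => z⁻¹ ^ n * g z) 0 1 with ha
  have hinv : ∀ n : ℕ, ContinuousOn (fun z : ℂ => z⁻¹ ^ n) (sphere 0 1) := fun n =>
    (continuousOn_inv₀.mono fun z hz h => by simp [show z = 0 from h] at hz).pow n
  have haB : ∀ n, ‖a n‖ ≤ B := by
    intro n
    simp only [ha, Real.circleAverage_def, norm_smul]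
    have h := intervalIntegral.norm_integral_le_of_norm_le_const (a := 0) (b := 2 * Real.pi)
      (f := fun θ => (circleMap 0 1 θ)⁻¹ ^ n * g (circleMap 0 1 θ)) (C := B) fun θ _ => by
        simpa using hB (circleMap 0 1 θ) (by simp)
    rw [sub_zero, abs_of_pos (by positivity)] at h
    rw [Real.norm_of_nonneg (by positivity), inv_mul_le_iff₀ (by positivity)]
    linarith
  have hsum : HasSum (fun n => Real.circleAverage
      (fun z => (g z - g (t * z)) * (starRingEnd ℂ) ((t * z) ^ n * a n)) 0 1)
      (Real.circleAverage (fun z => (g z - g (t * z)) * (starRingEnd ℂ) (g (t * z))) 0 1) := by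
    simp only [Real.circleAverage_def]
    refine HasSum.const_smul _ (intervalIntegral.hasSum_integral_of_dominated_convergence
      (fun n _ => (B + B) * (t ^ n * B)) ?_ ?_ ?_ ?_ ?_)
    · intro n
      have hc : ContinuousOn (fun z => (g z - g (t * z)) * (starRingEnd ℂ) ((t * z) ^ n * a n))
          (sphere 0 1) :=
        (hgs.sub hgt).mul (Complex.continuous_conj.comp (by fun_prop)).continuousOn
      exact (hc.comp_continuous (f := fun θ => circleMap 0 1 θ) (by fun_prop)
        (by simp)).aestronglyMeasurable
    · refine fun n => Eventually.of_forall fun θ _ => ?_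
      rw [norm_mul, RCLike.norm_conj, norm_mul, norm_pow]
      refine mul_le_mul ((norm_sub_le _ _).trans (add_le_add (hB _ (by simp))
        (hB _ (hmaps (by simp))))) ?_ (by positivity) (by positivity)
      simp only [norm_mul, norm_real, norm_circleMap_zero, abs_one, mul_one,
        Real.norm_of_nonneg ht0.le]
      gcongr
      exact haB n
    · exact Eventually.of_forall fun θ _ =>
        ((summable_geometric_of_lt_one ht0.le ht1).mul_right _).mul_left _
    · exact intervalIntegrable_const
    · refine Eventually.of_forall fun θ _ => HasSum.mul_left _ ?_
      exact (hasSum_circleAverage_inv_pow_mul hg (by simp [abs_of_pos ht0, ht1])).map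
        (starRingEnd ℂ) Complex.continuous_conj
  have hterm : ∀ n : ℕ, Real.circleAverage
      (fun z => (g z - g (t * z)) * (starRingEnd ℂ) ((t * z) ^ n * a n)) 0 1 =
      ((‖a n‖ ^ 2 * (t ^ n * (1 - t ^ n)) : ℝ) : ℂ) := by
    intro n
    have h1 : Real.circleAverage
        (fun z => (g z - g (t * z)) * (starRingEnd ℂ) ((t * z) ^ n * a n)) 0 1 =
        Real.circleAverage (fun z => (t ^ n * (starRingEnd ℂ) (a n)) •
          (z⁻¹ ^ n * g z - z⁻¹ ^ n * g (t * z))) 0 1 := by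
      refine Real.circleAverage_congr_sphere fun z hz => ?_
      have hz : ‖z‖ = 1 := by simpa using hz
      have : (starRingEnd ℂ) z = z⁻¹ := (inv_eq_conj hz).symm
      simp only [map_mul, map_pow, this, conj_ofReal, smul_eq_mul, mul_pow]
      ring
    rw [h1, Real.circleAverage_fun_smul, Real.circleAverage_fun_sub
      (f₁ := fun z => z⁻¹ ^ n * g z) (f₂ := fun z => z⁻¹ ^ n * g (t * z))
      (circleIntegrable_of_continuousOn_sphere ((hinv n).mul hgs))
      (circleIntegrable_of_continuousOn_sphere ((hinv n).mul hgt)),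
      circleAverage_inv_pow_mul_dilate hg ht0 ht1.le, smul_eq_mul]
    change _ * (a n - _ * a n) = _
    push_cast
    rw [← Complex.mul_conj']
    ring
  simp only [hterm] at hsum
  have hre := Complex.reCLM.hasSum hsum
  refine hre.nonneg fun n => ?_
  simp only [reCLM_apply, ofReal_re]
  have : t ^ n ≤ 1 := pow_le_one₀ ht0.le ht1.le
  have : 0 ≤ 1 - t ^ n := by linarith
  positivity

lemma circleMeanPow_two_sub_dilate_le {g : ℂ → ℂ} (hg : DiffContOnCl ℂ g (ball 0 1))
    {t : ℝ} (ht0 : 0 < t) (ht1 : t < 1) :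
    circleMeanPow 2 (fun z => g z - g (t * z)) ≤
      circleMeanPow 2 g - circleMeanPow 2 (fun z => g (t * z)) := by
  have hgc : ContinuousOn g (closedBall 0 1) := by
    simpa [closure_ball] using hg.continuousOn
  have hmaps : MapsTo (fun z : ℂ => t * z) (sphere 0 1) (closedBall 0 1) := by
    intro z hz
    have hz : ‖z‖ = 1 := by simpa using hz
    simp [hz, abs_of_pos ht0, ht1.le]
  have hgs : ContinuousOn g (sphere 0 1) := hgc.mono sphere_subset_closedBall
  have hgt : ContinuousOn (fun z => g (t * z)) (sphere 0 1) := hgc.comp (by fun_prop) hmaps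
  have hd := hgs.sub hgt
  have hprod : ContinuousOn (fun z => (g z - g (t * z)) * (starRingEnd ℂ) (g (t * z)))
      (sphere 0 1) := hd.mul (Complex.continuous_conj.comp_continuousOn hgt)
  have hpos := re_circleAverage_sub_dilate_mul_conj_nonneg hg ht0 ht1
  have hre := Complex.reCLM.circleAverage_comp_comm (c := 0) (R := 1)
    (circleIntegrable_of_continuousOn_sphere hprod)
  rw [reCLM_apply] at hre
  rw [← hre] at hpos
  have hnorm : ∀ z, ‖g z‖ ^ 2 = ‖g z - g (t * z)‖ ^ 2 + ‖g (t * z)‖ ^ 2 +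
      2 * ((g z - g (t * z)) * (starRingEnd ℂ) (g (t * z))).re := by
    intro z
    simp only [← normSq_eq_norm_sq, normSq_apply, sub_re, sub_im, mul_re, conj_re, conj_im]
    ring
  simp only [circleMeanPow, Real.rpow_two]
  have h1 : Real.circleAverage (fun z => ‖g z‖ ^ 2) 0 1 =
      Real.circleAverage (fun z => ‖g z - g (t * z)‖ ^ 2) 0 1 +
      Real.circleAverage (fun z => ‖g (t * z)‖ ^ 2) 0 1 +
      2 * Real.circleAverage
        (reCLM ∘ fun z => (g z - g (t * z)) * (starRingEnd ℂ) (g (t * z))) 0 1 := by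
    have i1 : CircleIntegrable (fun z => ‖g z - g (t * z)‖ ^ 2) 0 1 :=
      circleIntegrable_of_continuousOn_sphere (hd.norm.pow 2)
    have i2 : CircleIntegrable (fun z => ‖g (t * z)‖ ^ 2) 0 1 :=
      circleIntegrable_of_continuousOn_sphere (hgt.norm.pow 2)
    have i3 : CircleIntegrable (fun z => (2 : ℝ) •
        ((g z - g (t * z)) * (starRingEnd ℂ) (g (t * z))).re) 0 1 :=
      circleIntegrable_of_continuousOn_sphere
        ((reCLM.continuous.comp_continuousOn hprod).const_smul (2 : ℝ))
    have e1 := Real.circleAverage_fun_add i1 i2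
    have e2 := Real.circleAverage_fun_add (i1.fun_add i2) i3
    rw [Real.circleAverage_fun_smul, e1] at e2
    rw [show (fun z => ‖g z‖ ^ 2) = _ from funext hnorm]
    exact e2
  linarith

/-- `f` is, on the closed unit disk, a product of two functions of the disk algebra both of whose
squares have modulus `‖f‖` on the unit circle. -/
def HasBalancedFactorization (f : ℂ → ℂ) : Prop :=
  ∃ g h : ℂ → ℂ, DiffContOnCl ℂ g (ball 0 1) ∧ DiffContOnCl ℂ h (ball 0 1) ∧
    (∀ z ∈ closedBall (0 : ℂ) 1, f z = g z * h z) ∧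
    ∀ z ∈ sphere (0 : ℂ) 1, ‖g z‖ ^ 2 = ‖f z‖ ∧ ‖h z‖ ^ 2 = ‖f z‖

lemma HasBalancedFactorization.mul {f₁ f₂ : ℂ → ℂ} (h₁ : HasBalancedFactorization f₁)
    (h₂ : HasBalancedFactorization f₂) : HasBalancedFactorization fun z => f₁ z * f₂ z := by
  obtain ⟨g₁, k₁, hg₁, hk₁, hf₁, hs₁⟩ := h₁
  obtain ⟨g₂, k₂, hg₂, hk₂, hf₂, hs₂⟩ := h₂
  refine ⟨fun z => g₁ z * g₂ z, fun z => k₁ z * k₂ z, hg₁.smul hg₂, hk₁.smul hk₂, ?_, ?_⟩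
  · intro z hz
    simp only [hf₁ z hz, hf₂ z hz]
    ring
  · intro z hz
    simp only [norm_mul, mul_pow, (hs₁ z hz).1, (hs₁ z hz).2, (hs₂ z hz).1, (hs₂ z hz).2, and_self]

lemma DiffContOnCl.hasBalancedFactorization_sq {s : ℂ → ℂ} (hs : DiffContOnCl ℂ s (ball 0 1)) :
    HasBalancedFactorization fun z => s z ^ 2 :=
  ⟨s, s, hs, hs, fun _ _ => sq _, by simp⟩

lemma hasBalancedFactorization_const (c : ℂ) : HasBalancedFactorization fun _ => c := by
  obtain ⟨d, rfl⟩ := IsAlgClosed.exists_pow_nat_eq c two_pos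
  exact diffContOnCl_const.hasBalancedFactorization_sq

lemma diffContOnCl_sqrt_one_sub_mul {b : ℂ} (hb : ‖b‖ ≤ 1) :
    DiffContOnCl ℂ (fun z => (1 - b * z) ^ (1 / 2 : ℂ)) (ball 0 1) := by
  have hre : ∀ z : ℂ, (b * z).re ≤ ‖z‖ := fun z => (re_le_norm _).trans <| by
    rw [norm_mul]
    exact mul_le_of_le_one_left (norm_nonneg _) hb
  constructor
  · intro z hz
    have hz : ‖z‖ < 1 := by simpa using hz
    refine (DifferentiableAt.cpow_const (by fun_prop) (Or.inl ?_)).differentiableWithinAt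
    simpa using (hre z).trans_lt hz
  · rw [closure_ball _ one_ne_zero]
    intro z hz
    have hz : ‖z‖ ≤ 1 := by simpa using hz
    refine ContinuousAt.continuousWithinAt ?_
    have h := continuousAt_cpow_const_of_re_pos (z := 1 - b * z) (w := 1 / 2)
      (Or.inl (by simpa using (hre z).trans hz)) (by norm_num)
    exact ContinuousAt.comp (f := fun z => 1 - b * z) h (by fun_prop)

lemma hasBalancedFactorization_sub (a : ℂ) : HasBalancedFactorization fun z => z - a := by
  have hsq : ∀ w : ℂ, (w ^ (1 / 2 : ℂ)) ^ 2 = w := fun w => by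
    simp
  rcases le_or_gt 1 ‖a‖ with ha | ha
  · have ha0 : a ≠ 0 := by
      rintro rfl
      simp at ha
      linarith
    have h := (hasBalancedFactorization_const (-a)).mul
      (diffContOnCl_sqrt_one_sub_mul (b := a⁻¹)
        (by simpa using inv_le_one_of_one_le₀ ha)).hasBalancedFactorization_sq
    refine (congrArg HasBalancedFactorization (funext fun z => ?_)).mp h
    rw [hsq]
    field_simp
    ring
  · have hd := diffContOnCl_sqrt_one_sub_mul (b := (starRingEnd ℂ) a) (by simpa using ha.le)
    have hne : ∀ z ∈ closedBall (0 : ℂ) 1, 1 - (starRingEnd ℂ) a * z ≠ 0 := by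
      intro z hz h
      have hz : ‖z‖ ≤ 1 := by simpa using hz
      have h1 : ‖(starRingEnd ℂ) a * z‖ = 1 := by rw [← sub_eq_zero.1 h, norm_one]
      rw [norm_mul, RCLike.norm_conj] at h1
      nlinarith [norm_nonneg a, norm_nonneg z]
    have hne' : ∀ z ∈ closedBall (0 : ℂ) 1, (1 - (starRingEnd ℂ) a * z) ^ (1 / 2 : ℂ) ≠ 0 :=
      fun z hz h => hne z hz (by rw [← hsq (1 - _), h]; simp)
    refine ⟨_, fun z => (z - a) * ((1 - (starRingEnd ℂ) a * z) ^ (1 / 2 : ℂ))⁻¹, hd,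
      DiffContOnCl.smul (differentiable_id.diffContOnCl.sub_const a) (hd.inv ?_), fun z hz => ?_, fun z hz => ?_⟩
    · rwa [closure_ball _ one_ne_zero]
    · rw [mul_left_comm, mul_inv_cancel₀ (hne' z hz), mul_one]
    · have hzc := sphere_subset_closedBall hz
      have hz : ‖z‖ = 1 := by simpa using hz
      have h1 : ‖1 - (starRingEnd ℂ) a * z‖ = ‖z - a‖ := by
        have : 1 - (starRingEnd ℂ) a * z = z * (starRingEnd ℂ) (z - a) := by
          rw [map_sub, mul_sub, Complex.mul_conj']
          simp [hz, mul_comm]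
        rw [this, norm_mul, hz, one_mul, RCLike.norm_conj]
      have h2 : ‖(1 - (starRingEnd ℂ) a * z) ^ (1 / 2 : ℂ)‖ ^ 2 = ‖z - a‖ := by
        rw [← norm_pow, hsq, h1]
      refine ⟨h2, ?_⟩
      have h3 : ‖z - a‖ ≠ 0 := by
        rw [← h1]
        exact norm_ne_zero_iff.2 (hne z hzc)
      rw [norm_mul, norm_inv, mul_pow, inv_pow, h2]
      field_simp

lemma Polynomial.hasBalancedFactorization (q : ℂ[X]) :
    HasBalancedFactorization fun z => q.eval z := by
  have hprod : ∀ m : Multiset ℂ,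
      HasBalancedFactorization fun z => (m.map fun a => X - C a).prod.eval z := by
    intro m
    induction m using Multiset.induction with
    | empty => simpa using hasBalancedFactorization_const 1
    | cons a m ih => simpa using (hasBalancedFactorization_sub a).mul ih
  have h := (hasBalancedFactorization_const q.leadingCoeff).mul (hprod q.roots)
  rw [(IsAlgClosed.splits q).eq_prod_roots]
  simpa using h

lemma circleAverage_mul_sq_le {u v : ℂ → ℝ} (hu : ContinuousOn u (sphere 0 1))
    (hv : ContinuousOn v (sphere 0 1)) :
    Real.circleAverage (fun z => u z * v z) 0 1 ^ 2 ≤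
      Real.circleAverage (fun z => u z ^ 2) 0 1 * Real.circleAverage (fun z => v z ^ 2) 0 1 := by
  have h : ∀ x : ℝ, 0 ≤ Real.circleAverage (fun z => u z ^ 2) 0 1 * (x * x) +
      (-2 * Real.circleAverage (fun z => u z * v z) 0 1) * x +
      Real.circleAverage (fun z => v z ^ 2) 0 1 := by
    intro x
    have h0 : 0 ≤ Real.circleAverage (fun z => (x * u z - v z) ^ 2) 0 1 :=
      Real.circleAverage_nonneg_of_nonneg fun z _ => sq_nonneg _
    have i1 : CircleIntegrable (fun z => (x * x) • u z ^ 2) 0 1 :=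
      circleIntegrable_of_continuousOn_sphere (by fun_prop)
    have i2 : CircleIntegrable (fun z => (-2 * x) • (u z * v z)) 0 1 :=
      circleIntegrable_of_continuousOn_sphere (by fun_prop)
    have i3 : CircleIntegrable (fun z => v z ^ 2) 0 1 :=
      circleIntegrable_of_continuousOn_sphere (by fun_prop)
    have e1 := Real.circleAverage_fun_add i1 i2
    have e2 := Real.circleAverage_fun_add (i1.fun_add i2) i3
    rw [e1, Real.circleAverage_fun_smul, Real.circleAverage_fun_smul] at e2
    have e3 : (fun z => (x * u z - v z) ^ 2) =
        fun z => (x * x) • u z ^ 2 + (-2 * x) • (u z * v z) + v z ^ 2 := by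
      ext z
      simp only [smul_eq_mul]
      ring
    rw [e3, e2] at h0
    simp only [smul_eq_mul] at h0
    linarith
  have := discrim_le_zero h
  rw [discrim] at this
  linarith

lemma circleMeanPow_one_mul_le {g h : ℂ → ℂ} (hg : ContinuousOn g (sphere 0 1))
    (hh : ContinuousOn h (sphere 0 1)) :
    circleMeanPow 1 (fun z => g z * h z) ≤ √(circleMeanPow 2 g * circleMeanPow 2 h) := by
  refine Real.le_sqrt_of_sq_le ?_
  simpa [circleMeanPow] using circleAverage_mul_sq_le hg.norm hh.norm

lemma circleMeanPow_congr {p : ℝ} {F G : ℂ → ℂ} (h : ∀ z ∈ sphere (0 : ℂ) 1, F z = G z) :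
    circleMeanPow p F = circleMeanPow p G :=
  Real.circleAverage_congr_sphere fun z hz => by
    simp only [h z (by simpa using hz)]

lemma circleMeanPow_one_le_add {F G H : ℂ → ℂ} (hF : ContinuousOn F (sphere 0 1))
    (hG : ContinuousOn G (sphere 0 1)) (hH : ContinuousOn H (sphere 0 1))
    (h : ∀ z ∈ sphere (0 : ℂ) 1, ‖H z‖ ≤ ‖F z‖ + ‖G z‖) :
    circleMeanPow 1 H ≤ circleMeanPow 1 F + circleMeanPow 1 G := by
  simp only [circleMeanPow, Real.rpow_one]
  rw [← Real.circleAverage_fun_add (circleIntegrable_of_continuousOn_sphere hF.norm)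
    (circleIntegrable_of_continuousOn_sphere hG.norm)]
  exact circleAverage_unit_mono hH.norm (hF.norm.add hG.norm) h

lemma mapsTo_ofReal_mul_closedBall {t : ℝ} (ht0 : 0 ≤ t) (ht1 : t ≤ 1) :
    MapsTo (fun z : ℂ => t * z) (closedBall 0 1) (closedBall 0 1) := by
  intro z hz
  have hz : ‖z‖ ≤ 1 := by simpa using hz
  simpa [abs_of_nonneg ht0] using mul_le_one₀ ht1 (norm_nonneg z) hz

lemma DiffContOnCl.continuousOn_sphere {g : ℂ → ℂ} (hg : DiffContOnCl ℂ g (ball 0 1)) :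
    ContinuousOn g (sphere 0 1) :=
  hg.continuousOn_ball.mono sphere_subset_closedBall

lemma DiffContOnCl.continuousOn_dilate {g : ℂ → ℂ} (hg : DiffContOnCl ℂ g (ball 0 1))
    {t : ℝ} (ht0 : 0 ≤ t) (ht1 : t ≤ 1) : ContinuousOn (fun z => g (t * z)) (sphere 0 1) :=
  hg.continuousOn_ball.comp (by fun_prop)
    ((mapsTo_ofReal_mul_closedBall ht0 ht1).mono_left sphere_subset_closedBall)

lemma HasBalancedFactorization.circleMeanPow_one_sub_dilate_le {F : ℂ → ℂ}
    (hF : HasBalancedFactorization F) {t : ℝ} (ht0 : 0 < t) (ht1 : t < 1) :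
    circleMeanPow 1 (fun z => F z - F (t * z)) ≤
      2 * √(circleMeanPow 1 F ^ 2 - circleMeanPow 1 (fun z => F (t * z)) ^ 2) := by
  obtain ⟨g, h, hg, hh, hfac, hmod⟩ := hF
  have hgs := hg.continuousOn_sphere
  have hhs := hh.continuousOn_sphere
  have hgt := hg.continuousOn_dilate ht0.le ht1.le
  have hht := hh.continuousOn_dilate ht0.le ht1.le
  have hSg : circleMeanPow 2 g = circleMeanPow 1 F :=
    Real.circleAverage_congr_sphere fun z hz => by simpa using (hmod z (by simpa using hz)).1
  have hSh : circleMeanPow 2 h = circleMeanPow 1 F :=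
    Real.circleAverage_congr_sphere fun z hz => by simpa using (hmod z (by simpa using hz)).2
  have hdg := circleMeanPow_two_sub_dilate_le hg ht0 ht1
  have hdh := circleMeanPow_two_sub_dilate_le hh ht0 ht1
  have hT : circleMeanPow 1 (fun z => F (t * z)) ≤
      √(circleMeanPow 2 (fun z => g (t * z)) * circleMeanPow 2 (fun z => h (t * z))) := by
    rw [circleMeanPow_congr (F := fun z => F (t * z)) (G := fun z => g (t * z) * h (t * z))
      fun z hz => hfac _ (mapsTo_ofReal_mul_closedBall ht0.le ht1.le (sphere_subset_closedBall hz))]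
    exact circleMeanPow_one_mul_le hgt hht
  have hD : circleMeanPow 1 (fun z => F z - F (t * z)) ≤
      √(circleMeanPow 2 (fun z => g z - g (t * z)) * circleMeanPow 2 h) +
      √(circleMeanPow 2 (fun z => g (t * z)) * circleMeanPow 2 (fun z => h z - h (t * z))) := by
    have hFe : ∀ z ∈ sphere (0 : ℂ) 1, F z - F (t * z) =
        (g z - g (t * z)) * h z + g (t * z) * (h z - h (t * z)) := by
      intro z hz
      rw [hfac z (sphere_subset_closedBall hz),
        hfac _ (mapsTo_ofReal_mul_closedBall ht0.le ht1.le (sphere_subset_closedBall hz))]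
      ring
    rw [circleMeanPow_congr hFe]
    refine (circleMeanPow_one_le_add ((hgs.sub hgt).mul hhs) (hgt.mul (hhs.sub hht))
      (((hgs.sub hgt).mul hhs).add (hgt.mul (hhs.sub hht))) fun z _ => norm_add_le _ _).trans ?_
    exact add_le_add (circleMeanPow_one_mul_le (hgs.sub hgt) hhs)
      (circleMeanPow_one_mul_le hgt (hhs.sub hht))
  rw [hSg] at hdg
  rw [hSh] at hdh hD
  have n0 := circleMeanPow_nonneg 1 F
  have n1 := circleMeanPow_nonneg 1 fun z => F (t * z)
  have n2 := circleMeanPow_nonneg 2 fun z => g (t * z)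
  have n3 := circleMeanPow_nonneg 2 fun z => h (t * z)
  have n4 := circleMeanPow_nonneg 2 fun z => g z - g (t * z)
  have n5 := circleMeanPow_nonneg 2 fun z => h z - h (t * z)
  have hT2 := (Real.le_sqrt n1 (mul_nonneg n2 n3)).1 hT
  refine hD.trans ?_
  rw [two_mul]
  generalize circleMeanPow 1 F = S at *
  generalize circleMeanPow 2 (fun z => g (t * z)) = a at *
  generalize circleMeanPow 2 (fun z => h (t * z)) = b at *
  refine add_le_add (Real.sqrt_le_sqrt ?_) (Real.sqrt_le_sqrt ?_)
  · nlinarith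
  · nlinarith

lemma abs_circleMeanPow_one_sub_le {F G : ℂ → ℂ} (hF : ContinuousOn F (sphere 0 1))
    (hG : ContinuousOn G (sphere 0 1)) {ε : ℝ} (h : ∀ z ∈ sphere (0 : ℂ) 1, ‖F z - G z‖ ≤ ε) :
    |circleMeanPow 1 F - circleMeanPow 1 G| ≤ ε := by
  have hd : circleMeanPow 1 (fun z => F z - G z) ≤ ε := by
    simpa [Pi.sub_def] using circleMeanPow_le_of_norm_le zero_le_one (hF.sub hG) h
  have h1 := circleMeanPow_one_le_add (hF.sub hG) hG hF fun z _ => by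
    simpa using norm_add_le (F z - G z) (G z)
  have h2 := circleMeanPow_one_le_add (hF.sub hG) hF hG fun z _ => by
    simpa [norm_sub_rev] using norm_add_le (G z - F z) (F z)
  simp only [Pi.sub_def] at h1 h2
  rw [abs_le]
  constructor <;> linarith

lemma circleMeanPow_one_sub_dilate_le {R : ℝ} (hR : 1 < R) {F : ℂ → ℂ}
    (hF : DifferentiableOn ℂ F (ball 0 R)) {t : ℝ} (ht0 : 0 < t) (ht1 : t < 1) :
    circleMeanPow 1 (fun z => F z - F (t * z)) ≤
      2 * √(circleMeanPow 1 F ^ 2 - circleMeanPow 1 (fun z => F (t * z)) ^ 2) := by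
  have hF' : DiffContOnCl ℂ F (ball 0 1) :=
    (hF.mono (by rw [closure_ball _ one_ne_zero]; exact closedBall_subset_ball hR)).diffContOnCl
  have hFs := hF'.continuousOn_sphere
  have hFt := hF'.continuousOn_dilate ht0.le ht1.le
  choose q hq using fun n : ℕ => exists_polynomial_approx hR hF (ε := 1 / (n + 1)) (by positivity)
  have hqs : ∀ n, ContinuousOn (fun z => (q n).eval z) (sphere 0 1) := fun n => by fun_prop
  have hqt : ∀ n, ContinuousOn (fun z : ℂ => (q n).eval (t * z)) (sphere 0 1) := fun n => by fun_prop
  have hmaps := mapsTo_ofReal_mul_closedBall ht0.le ht1.le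
  have hlim := tendsto_one_div_add_atTop_nhds_zero_nat (𝕜 := ℝ)
  have key : ∀ (A : ℝ) (B : ℕ → ℝ), (∀ n, |A - B n| ≤ 2 * (1 / ((n : ℝ) + 1))) →
      Tendsto B atTop (𝓝 A) := by
    intro A B h
    rw [tendsto_iff_dist_tendsto_zero]
    refine squeeze_zero (fun _ => dist_nonneg) (fun n => ?_) (by simpa using hlim.const_mul 2)
    rw [dist_comm, Real.dist_eq]
    simpa using h n
  have hle : ∀ n : ℕ, (1 : ℝ) / (n + 1) ≤ 2 * (1 / (n + 1)) := fun n => by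
    have : (0 : ℝ) ≤ 1 / (n + 1) := by positivity
    linarith
  have l1 := key _ _ fun n => (abs_circleMeanPow_one_sub_le hFs (hqs n) fun z hz =>
    (hq n z (sphere_subset_closedBall hz)).le).trans (hle n)
  have l2 := key _ _ fun n => (abs_circleMeanPow_one_sub_le hFt (hqt n) fun z hz =>
    (hq n _ (hmaps (sphere_subset_closedBall hz))).le).trans (hle n)
  have l3 := key _ _ fun n => abs_circleMeanPow_one_sub_le (hFs.sub hFt)
    ((hqs n).sub (hqt n)) fun z hz => by
      have h1 := hq n z (sphere_subset_closedBall hz)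
      have h2 := hq n _ (hmaps (sphere_subset_closedBall hz))
      have h3 := norm_sub_le (F z - (q n).eval z) (F (t * z) - (q n).eval (t * z))
      simp only [Pi.sub_apply]
      rw [sub_sub_sub_comm, two_mul]
      exact h3.trans (add_le_add h1.le h2.le)
  exact le_of_tendsto_of_tendsto' l3 (((l1.pow 2).sub (l2.pow 2)).sqrt.const_mul 2) fun n =>
    (q n).hasBalancedFactorization.circleMeanPow_one_sub_dilate_le ht0 ht1

lemma norm_half_add_rpow_le {p : ℝ} (hp : 1 ≤ p) (a b : ℂ) :
    ‖(a + b) / 2‖ ^ p ≤ (‖a‖ ^ p + ‖b‖ ^ p) / 2 := by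
  have h1 : ‖(a + b) / 2‖ ≤ (1 / 2 : ℝ) * ‖a‖ + (1 / 2 : ℝ) * ‖b‖ := by
    rw [norm_div, Complex.norm_ofNat]
    linarith [norm_add_le a b]
  have h2 := (convexOn_rpow hp).2 (norm_nonneg a) (norm_nonneg b)
    (show (0 : ℝ) ≤ 1 / 2 by norm_num) (show (0 : ℝ) ≤ 1 / 2 by norm_num) (by norm_num)
  simp only [smul_eq_mul] at h2
  linarith [Real.rpow_le_rpow (norm_nonneg _) h1 (by linarith : 0 ≤ p)]

lemma norm_half_add_rpow_lt {p : ℝ} (hp : 1 < p) {a b : ℂ} (hab : a ≠ b) :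
    ‖(a + b) / 2‖ ^ p < (‖a‖ ^ p + ‖b‖ ^ p) / 2 := by
  have hp0 : 0 < p := by linarith
  by_cases h : ‖a‖ = ‖b‖
  · have h1 := (norm_midpoint_lt_iff h).2 hab
    have h2 : ‖(a + b) / 2‖ < ‖a‖ := by
      rw [norm_smul] at h1
      rw [norm_div, Complex.norm_ofNat]
      norm_num at h1
      linarith
    linarith [Real.rpow_lt_rpow (norm_nonneg _) h2 hp0, congrArg (· ^ p) h]
  · have h1 : ‖(a + b) / 2‖ ≤ (1 / 2 : ℝ) * ‖a‖ + (1 / 2 : ℝ) * ‖b‖ := by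
      rw [norm_div, Complex.norm_ofNat]
      linarith [norm_add_le a b]
    have h2 := (strictConvexOn_rpow hp).2 (norm_nonneg a) (norm_nonneg b) h
      (show (0 : ℝ) < 1 / 2 by norm_num) (show (0 : ℝ) < 1 / 2 by norm_num) (by norm_num)
    simp only [smul_eq_mul] at h2
    linarith [Real.rpow_le_rpow (norm_nonneg _) h1 hp0.le]

lemma exists_norm_sub_rpow_le {p : ℝ} (hp : 1 < p) {ε : ℝ} (hε : 0 < ε) :
    ∃ C : ℝ, 0 ≤ C ∧ ∀ a b : ℂ, ‖a - b‖ ^ p ≤ ε * (‖a‖ ^ p + ‖b‖ ^ p) +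
      C * ((‖a‖ ^ p + ‖b‖ ^ p) / 2 - ‖(a + b) / 2‖ ^ p) := by
  have hp0 : 0 < p := by linarith
  set Φ : ℂ × ℂ → ℝ := fun x => ‖x.1 - x.2‖ ^ p - ε * (‖x.1‖ ^ p + ‖x.2‖ ^ p) with hΦ
  set φ : ℂ × ℂ → ℝ := fun x => (‖x.1‖ ^ p + ‖x.2‖ ^ p) / 2 - ‖(x.1 + x.2) / 2‖ ^ p with hφ
  have hΦc : Continuous Φ := by
    have : ∀ {u : ℂ × ℂ → ℂ}, Continuous u → Continuous fun x => ‖u x‖ ^ p :=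
      fun hu => hu.norm.rpow_const fun _ => Or.inr hp0.le
    exact (this (by fun_prop)).sub (continuous_const.mul ((this (by fun_prop)).add
      (this (by fun_prop))))
  have hφc : Continuous φ := by
    have : ∀ {u : ℂ × ℂ → ℂ}, Continuous u → Continuous fun x => ‖u x‖ ^ p :=
      fun hu => hu.norm.rpow_const fun _ => Or.inr hp0.le
    exact (((this (by fun_prop)).add (this (by fun_prop))).div_const 2).sub (this (by fun_prop))
  have hφ0 : ∀ x, 0 ≤ φ x := fun x => sub_nonneg.2 (norm_half_add_rpow_le hp.le _ _)
  have hcomp : IsCompact (sphere (0 : ℂ × ℂ) 1 ∩ {x | 0 ≤ Φ x}) :=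
    (isCompact_sphere _ _).inter_right (isClosed_le continuous_const hΦc)
  have hpos : ∀ x ∈ sphere (0 : ℂ × ℂ) 1 ∩ {x | 0 ≤ Φ x}, 0 < φ x := by
    rintro ⟨a, b⟩ ⟨hx, hx0⟩
    refine sub_pos.2 (norm_half_add_rpow_lt hp ?_)
    rintro (rfl : a = b)
    have ha : ‖a‖ = 1 := by simpa using hx
    simp [hΦ, ha, hp0.ne'] at hx0
    linarith
  obtain ⟨C, hC0, hC⟩ : ∃ C : ℝ, 0 ≤ C ∧ ∀ x ∈ sphere (0 : ℂ × ℂ) 1, Φ x ≤ C * φ x := by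
    rcases (sphere (0 : ℂ × ℂ) 1 ∩ {x | 0 ≤ Φ x}).eq_empty_or_nonempty with he | hne
    · refine ⟨0, le_rfl, fun x hx => ?_⟩
      by_contra! h
      have : x ∈ sphere (0 : ℂ × ℂ) 1 ∩ {x | 0 ≤ Φ x} := ⟨hx, by simpa using h.le⟩
      simp [he] at this
    · obtain ⟨x₀, hx₀, hmin⟩ := hcomp.exists_isMinOn hne hφc.continuousOn
      obtain ⟨x₁, hx₁, hmax⟩ := hcomp.exists_isMaxOn hne hΦc.continuousOn
      have h0 := hpos x₀ hx₀
      have h1 : 0 ≤ Φ x₁ := hx₁.2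
      refine ⟨Φ x₁ / φ x₀, by positivity, fun x hx => ?_⟩
      by_cases h : 0 ≤ Φ x
      · have h2 : Φ x ≤ Φ x₁ := hmax ⟨hx, h⟩
        have h3 : φ x₀ ≤ φ x := hmin ⟨hx, h⟩
        calc Φ x ≤ Φ x₁ := h2
          _ = Φ x₁ / φ x₀ * φ x₀ := by field_simp
          _ ≤ _ := by gcongr
      · exact (not_le.1 h).le.trans (mul_nonneg (by positivity) (hφ0 x))
  refine ⟨C, hC0, fun a b => ?_⟩
  suffices h : Φ (a, b) ≤ C * φ (a, b) by
    simp only [hΦ, hφ] at h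
    linarith
  by_cases h0 : (a, b) = (0 : ℂ × ℂ)
  · obtain ⟨rfl, rfl⟩ := Prod.mk_eq_zero.1 h0
    simp [hΦ, hφ, hp0.ne']
  have hn : 0 < ‖(a, b)‖ := norm_pos_iff.2 h0
  set k : ℝ := ‖(a, b)‖⁻¹ with hk
  have hk0 : 0 < k := inv_pos.2 hn
  have h := hC (k • (a, b)) (by
    rw [mem_sphere_zero_iff_norm, norm_smul, Real.norm_of_nonneg hk0.le, hk,
      inv_mul_cancel₀ hn.ne'])
  have hsc : ∀ c : ℂ, ‖(k : ℂ) * c‖ ^ p = k ^ p * ‖c‖ ^ p := fun c => by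
    rw [norm_mul, norm_real, Real.norm_of_nonneg hk0.le, Real.mul_rpow hk0.le (norm_nonneg _)]
  have e1 : Φ (k • (a, b)) = k ^ p * Φ (a, b) := by
    simp only [hΦ, Prod.smul_mk, real_smul, ← mul_sub, hsc]
    ring
  have e2 : φ (k • (a, b)) = k ^ p * φ (a, b) := by
    simp only [hφ, Prod.smul_mk, real_smul, ← mul_add, mul_div_assoc, hsc]
    ring
  rw [e1, e2, mul_left_comm] at h
  exact le_of_mul_le_mul_left h (Real.rpow_pos_of_pos hk0 p)

lemma DifferentiableOn.dilate_of_pos {f : ℂ → ℂ} (hf : DifferentiableOn ℂ f (ball 0 1)) {r : ℝ}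
    (hr0 : 0 < r) : DifferentiableOn ℂ (fun z => f (r * z)) (ball 0 (1 / r)) := by
  refine hf.comp (by fun_prop) fun z hz => ?_
  have hz : ‖z‖ < 1 / r := by simpa using hz
  rw [lt_div_iff₀' hr0] at hz
  simpa [abs_of_pos hr0] using hz

lemma DifferentiableOn.dilate {f : ℂ → ℂ} (hf : DifferentiableOn ℂ f (ball 0 1)) {t : ℝ}
    (ht0 : 0 ≤ t) (ht1 : t ≤ 1) : DifferentiableOn ℂ (fun z => f (t * z)) (ball 0 1) := by
  refine hf.comp (by fun_prop) fun z hz => ?_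
  have hz : ‖z‖ < 1 := by simpa using hz
  simpa [abs_of_nonneg ht0] using mul_lt_one_of_nonneg_of_lt_one_right ht1 (norm_nonneg z) hz

lemma DifferentiableOn.diffContOnCl_dilate {f : ℂ → ℂ} (hf : DifferentiableOn ℂ f (ball 0 1))
    {r : ℝ} (hr0 : 0 < r) (hr1 : r < 1) : DiffContOnCl ℂ (fun z => f (r * z)) (ball 0 1) :=
  ((hf.dilate_of_pos hr0).mono (by
    rw [closure_ball _ one_ne_zero]
    exact closedBall_subset_ball ((one_lt_div hr0).2 hr1))).diffContOnCl

lemma circleMeanPow_dilate_mono {p : ℝ} (hp : 1 ≤ p) {f : ℂ → ℂ}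
    (hf : DifferentiableOn ℂ f (ball 0 1)) {r r' : ℝ} (hr : 0 ≤ r) (hrr' : r ≤ r') (hr' : r' < 1) :
    circleMeanPow p (fun z => f (r * z)) ≤ circleMeanPow p (fun z => f (r' * z)) := by
  rcases hrr'.eq_or_lt with rfl | hlt
  · rfl
  have h0 : 0 < r' := hr.trans_lt hlt
  have h := circleMeanPow_dilate_le hp (hf.diffContOnCl_dilate h0 hr') (div_nonneg hr h0.le)
    ((div_lt_one h0).2 hlt)
  have he : ∀ z : ℂ, (r' : ℂ) * (((r / r' : ℝ) : ℂ) * z) = r * z := fun z => by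
    rw [← mul_assoc, ← ofReal_mul, mul_div_cancel₀ _ h0.ne']
  simpa only [he] using h

lemma exists_circleMeanPow_one_sub_dilate_le {f : ℂ → ℂ} (hf : DifferentiableOn ℂ f (ball 0 1))
    {M : ℝ} (hM : IsLUB ((fun r : ℝ => circleMeanPow 1 fun z => f (r * z)) '' Ioo 0 1) M)
    {ε : ℝ} (hε : 0 < ε) :
    ∃ t ∈ Ioo (0 : ℝ) 1, ∀ r ∈ Ioo (0 : ℝ) 1,
      circleMeanPow 1 (fun z => f (r * z) - f (t * (r * z))) ≤ ε := by
  have hM0 : 0 ≤ M := (circleMeanPow_nonneg _ _).trans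
    (hM.1 (mem_image_of_mem _ (show (1 / 2 : ℝ) ∈ Ioo 0 1 by norm_num)))
  obtain ⟨_, ⟨r₀, hr₀, rfl⟩, hlt⟩ := hM.exists_between
    (show M - ε ^ 2 / (8 * (M + 1)) < M by
      have : 0 < ε ^ 2 / (8 * (M + 1)) := by positivity
      linarith)
  have ht0 : 0 < √r₀ := Real.sqrt_pos.2 hr₀.1
  have ht1 : √r₀ < 1 := by
    rw [Real.sqrt_lt' one_pos, one_pow]
    exact hr₀.2
  refine ⟨√r₀, ⟨ht0, ht1⟩, fun r hr => ?_⟩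
  have hD : DifferentiableOn ℂ (fun z => f z - f (√r₀ * z)) (ball 0 1) :=
    hf.sub (hf.dilate ht0.le ht1.le)
  have hs0 : 0 < max r √r₀ := lt_max_of_lt_left hr.1
  have hs1 : max r √r₀ < 1 := max_lt hr.2 ht1
  refine (circleMeanPow_dilate_mono le_rfl hD hr.1.le (le_max_left r √r₀) hs1).trans ?_
  generalize hs : max r √r₀ = s at *
  have hsr : r₀ ≤ s * √r₀ := by
    have : √r₀ ≤ s := by rw [← hs]; exact le_max_right _ _
    nlinarith [Real.mul_self_sqrt hr₀.1.le]
  have key := circleMeanPow_one_sub_dilate_le ((one_lt_div hs0).2 hs1) (hf.dilate_of_pos hs0)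
    ht0 ht1
  simp only [mul_left_comm (s : ℂ)] at key
  refine key.trans ?_
  have h1 : circleMeanPow 1 (fun z => f (s * z)) ≤ M := hM.1 (mem_image_of_mem _ ⟨hs0, hs1⟩)
  have h2 := circleMeanPow_dilate_mono le_rfl hf hr₀.1.le hsr (by nlinarith)
  simp only [ofReal_mul, mul_assoc, mul_left_comm (s : ℂ)] at h2
  have h3 := circleMeanPow_nonneg 1 fun z => f (s * z)
  have h4 := circleMeanPow_nonneg 1 fun z => f (r₀ * z)
  have h5 : ε ^ 2 / (8 * (M + 1)) * (8 * (M + 1)) = ε ^ 2 := by field_simp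
  have h6 : 0 ≤ ε ^ 2 / (8 * (M + 1)) := by positivity
  generalize ε ^ 2 / (8 * (M + 1)) = δ at *
  rw [← le_div_iff₀' two_pos]
  refine Real.sqrt_le_iff.2 ⟨by positivity, ?_⟩
  have h7 : circleMeanPow 1 (fun z => f (s * z)) ^ 2 ≤ M ^ 2 := by gcongr
  have h8 : circleMeanPow 1 (fun z => f (r₀ * z)) ^ 2 ≤
      circleMeanPow 1 (fun z => f (√r₀ * (s * z))) ^ 2 := by gcongr
  simp only at hlt
  have hle : circleMeanPow 1 (fun z => f (r₀ * z)) ≤ M := hM.1 (mem_image_of_mem _ hr₀)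
  nlinarith

lemma tendsto_circleMeanPow_half_add_dilate {p : ℝ} (hp : 0 ≤ p) {f : ℂ → ℂ}
    (hf : ContinuousOn f (ball 0 1)) {r : ℝ} (hr : r ∈ Ioo (0 : ℝ) 1) :
    Tendsto (fun t : ℝ => circleMeanPow p fun z => (f (r * z) + f (t * (r * z))) / 2)
      (𝓝[<] 1) (𝓝 (circleMeanPow p fun z => f (r * z))) := by
  set c : ℝ → ℝ := fun t => max 0 (min t 1) with hc
  have hcc : Continuous c := by fun_prop
  have hmem : ∀ t θ : ℝ, ((c t : ℝ) : ℂ) * (r * circleMap 0 1 θ) ∈ ball (0 : ℂ) 1 := by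
    intro t θ
    have h0 : 0 ≤ c t := le_max_left _ _
    have h1 : c t ≤ 1 := max_le zero_le_one (min_le_right _ _)
    simpa [abs_of_nonneg h0, abs_of_pos hr.1] using
      mul_lt_one_of_nonneg_of_lt_one_right h1 hr.1.le hr.2
  have hmem' : ∀ θ : ℝ, (r * circleMap 0 1 θ) ∈ ball (0 : ℂ) 1 := by
    intro θ
    simpa [abs_of_pos hr.1] using hr.2
  have hcont : Continuous fun x : ℝ × ℝ => ‖(f (r * circleMap 0 1 x.2) +
      f (c x.1 * (r * circleMap 0 1 x.2))) / 2‖ ^ p := by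
    refine Continuous.rpow_const (Continuous.norm (Continuous.div_const (Continuous.add ?_ ?_) 2))
      fun _ => Or.inr hp
    · exact hf.comp_continuous (by fun_prop) fun x => hmem' _
    · exact hf.comp_continuous (by fun_prop) fun x => hmem _ _
  have hint := intervalIntegral.continuous_parametric_intervalIntegral_of_continuous'
    (μ := volume) (f := fun t θ : ℝ => ‖(f (r * circleMap 0 1 θ) +
      f (c t * (r * circleMap 0 1 θ))) / 2‖ ^ p) hcont 0 (2 * Real.pi)
  have hlim : Tendsto
      (fun t : ℝ => circleMeanPow p fun z => (f (r * z) + f (c t * (r * z))) / 2) (𝓝[<] 1)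
      (𝓝 (circleMeanPow p fun z => (f (r * z) + f (c 1 * (r * z))) / 2)) := ((hint.const_smul (2 * Real.pi)⁻¹).tendsto 1).mono_left
    (nhdsWithin_le_nhds (s := Iio 1))
  have hc1 : c 1 = 1 := by simp [hc]
  simp only [hc1, ofReal_one, one_mul, add_self_div_two] at hlim
  refine hlim.congr' ?_
  filter_upwards [Ioo_mem_nhdsLT (show (0 : ℝ) < 1 by norm_num)] with t ht
  have : c t = t := by simp [hc, ht.1.le, ht.2.le]
  simp [this]

lemma exists_circleMeanPow_sub_dilate_le_of_one_lt {p : ℝ} (hp : 1 < p) {f : ℂ → ℂ}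
    (hf : DifferentiableOn ℂ f (ball 0 1))
    {M : ℝ} (hM : IsLUB ((fun r : ℝ => circleMeanPow p fun z => f (r * z)) '' Ioo 0 1) M)
    {ε : ℝ} (hε : 0 < ε) :
    ∃ t ∈ Ioo (0 : ℝ) 1, ∀ r ∈ Ioo (0 : ℝ) 1,
      circleMeanPow p (fun z => f (r * z) - f (t * (r * z))) ≤ ε := by
  have hp0 : 0 ≤ p := by linarith
  have hM0 : 0 ≤ M := (circleMeanPow_nonneg _ _).trans
    (hM.1 (mem_image_of_mem _ (show (1 / 2 : ℝ) ∈ Ioo 0 1 by norm_num)))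
  obtain ⟨C, hC0, hC⟩ := exists_norm_sub_rpow_le hp (ε := ε / (4 * (M + 1))) (by positivity)
  obtain ⟨_, ⟨r₀, hr₀, rfl⟩, hlt⟩ := hM.exists_between
    (show M - ε / (2 * (C + 1)) < M by
      have : 0 < ε / (2 * (C + 1)) := by positivity
      linarith)
  obtain ⟨t, htlt, ht⟩ := (((tendsto_circleMeanPow_half_add_dilate hp0 hf.continuousOn
    hr₀).eventually (lt_mem_nhds hlt.1)).and
    (Ioo_mem_nhdsLT (show (0 : ℝ) < 1 by norm_num))).exists
  refine ⟨t, ht, fun r hr => ?_⟩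
  have hft := hf.dilate ht.1.le ht.2.le
  have hD : DifferentiableOn ℂ (fun z => f z - f (t * z)) (ball 0 1) := hf.sub hft
  have hH : DifferentiableOn ℂ (fun z => (f z + f (t * z)) / 2) (ball 0 1) :=
    (hf.add hft).div_const 2
  have hs0 : 0 < max r r₀ := lt_max_of_lt_left hr.1
  have hs1 : max r r₀ < 1 := max_lt hr.2 hr₀.2
  refine (circleMeanPow_dilate_mono hp.le hD hr.1.le (le_max_left r r₀) hs1).trans ?_
  have hmono := circleMeanPow_dilate_mono hp.le hH hr₀.1.le (le_max_right r r₀) hs1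
  generalize max r r₀ = s at *
  have i1 := (hf.diffContOnCl_dilate hs0 hs1).continuousOn_sphere
  have i2 := (hft.diffContOnCl_dilate hs0 hs1).continuousOn_sphere
  have iD := (hD.diffContOnCl_dilate hs0 hs1).continuousOn_sphere
  have iH := (hH.diffContOnCl_dilate hs0 hs1).continuousOn_sphere
  have j1 := continuousOn_norm_rpow hp0 i1
  have j2 := continuousOn_norm_rpow hp0 i2
  have jH := continuousOn_norm_rpow hp0 iH
  have h1 : circleMeanPow p (fun z => f (s * z)) ≤ M := hM.1 (mem_image_of_mem _ ⟨hs0, hs1⟩)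
  have h2 : circleMeanPow p (fun z => f (t * (s * z))) ≤ M := by
    have := hM.1 (mem_image_of_mem (fun r : ℝ => circleMeanPow p fun z => f (r * z))
      (show t * s ∈ Ioo (0 : ℝ) 1 from ⟨mul_pos ht.1 hs0, by nlinarith [ht.1, ht.2]⟩))
    simpa [mul_assoc] using this
  set A := ε / (4 * (M + 1)) with hA
  have hA0 : 0 ≤ A := by positivity
  have hAM : A * M ≤ ε / 4 := by
    rw [hA, div_mul_eq_mul_div, div_le_div_iff₀ (by positivity) (by positivity)]
    nlinarith
  have key : circleMeanPow p (fun z => f (s * z) - f (t * (s * z))) ≤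
      Real.circleAverage (fun z => (A + C / 2) • ‖f (s * z)‖ ^ p +
        (A + C / 2) • ‖f (t * (s * z))‖ ^ p +
        (-C) • ‖(f (s * z) + f (t * (s * z))) / 2‖ ^ p) 0 1 := by
    refine circleAverage_unit_mono (continuousOn_norm_rpow hp0 iD)
      (((j1.const_smul (A + C / 2)).add (j2.const_smul (A + C / 2))).add
        (jH.const_smul (-C))) fun z _ => ?_
    have := hC (f (s * z)) (f (t * (s * z)))
    simp only [smul_eq_mul]
    linarith
  have k1 : CircleIntegrable (fun z => (A + C / 2) • ‖f (s * z)‖ ^ p) 0 1 :=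
    circleIntegrable_of_continuousOn_sphere (j1.const_smul (A + C / 2))
  have k2 : CircleIntegrable (fun z => (A + C / 2) • ‖f (t * (s * z))‖ ^ p) 0 1 :=
    circleIntegrable_of_continuousOn_sphere (j2.const_smul (A + C / 2))
  have k3 : CircleIntegrable
      (fun z => (-C) • ‖(f (s * z) + f (t * (s * z))) / 2‖ ^ p) 0 1 :=
    circleIntegrable_of_continuousOn_sphere (jH.const_smul (-C))
  rw [Real.circleAverage_fun_add (k1.fun_add k2) k3, Real.circleAverage_fun_add k1 k2,
    Real.circleAverage_fun_smul, Real.circleAverage_fun_smul,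
    Real.circleAverage_fun_smul] at key
  change _ ≤ (A + C / 2) • circleMeanPow p (fun z => f (s * z)) +
    (A + C / 2) • circleMeanPow p (fun z => f (t * (s * z))) +
    (-C) • circleMeanPow p (fun z => (f (s * z) + f (t * (s * z))) / 2) at key
  simp only [smul_eq_mul] at key
  have hCδ : C * (ε / (2 * (C + 1))) ≤ ε / 2 := by
    rw [mul_div_assoc', div_le_div_iff₀ (by positivity) (by positivity)]
    nlinarith
  have hlow : M - ε / (2 * (C + 1)) ≤
      circleMeanPow p (fun z => (f (s * z) + f (t * (s * z))) / 2) := htlt.le.trans hmono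
  have e1 := mul_le_mul_of_nonneg_left hlow hC0
  have e2 := mul_le_mul_of_nonneg_left h1 (show 0 ≤ A + C / 2 by positivity)
  have e3 := mul_le_mul_of_nonneg_left h2 (show 0 ≤ A + C / 2 by positivity)
  linarith

lemma exists_circleMeanPow_sub_dilate_le {p : ℝ} (hp : 1 ≤ p) {f : ℂ → ℂ}
    (hf : DifferentiableOn ℂ f (ball 0 1))
    (hb : BddAbove ((fun r : ℝ => circleMeanPow p fun z => f (r * z)) '' Ioo 0 1))
    {ε : ℝ} (hε : 0 < ε) :
    ∃ t ∈ Ioo (0 : ℝ) 1, ∀ r ∈ Ioo (0 : ℝ) 1,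
      circleMeanPow p (fun z => f (r * z) - f (t * (r * z))) ≤ ε := by
  have hM := isLUB_csSup ((nonempty_Ioo.2 (zero_lt_one' ℝ)).image _) hb
  rcases hp.eq_or_lt with rfl | hp
  · exact exists_circleMeanPow_one_sub_dilate_le hf hM hε
  · exact exists_circleMeanPow_sub_dilate_le_of_one_lt hp hf hM hε

lemma exists_finset_cover_card_mul_le {K : Set ℂ} (hKc : IsCompact K)
    (hKT : K ⊆ sphere (0 : ℂ) 1) (hKm : arcMeasure K = 0) {η : ℝ} (hη : 0 < η) :
    ∃ (δ : ℝ) (S : Finset ℂ), 0 < δ ∧ S.card * δ ≤ η ∧ (∀ w ∈ S, ‖w‖ = 1) ∧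
      ∀ ζ ∈ K, ∃ w ∈ S, ‖w - ζ‖ ≤ δ := by
  classical
  have hpi := Real.two_pi_pos
  set μ : Measure ℂ := (volume.restrict (Ico 0 (2 * Real.pi))).map (circleMap 0 1) with hμ
  have hmeas : Measurable (circleMap 0 1) := (continuous_circleMap 0 1).measurable
  have hμapp : ∀ E : Set ℂ, IsClosed E →
      μ E = volume (circleMap 0 1 ⁻¹' E ∩ Ico 0 (2 * Real.pi)) := fun E hE => by
    rw [hμ, Measure.map_apply hmeas hE.measurableSet,
      Measure.restrict_apply (hmeas hE.measurableSet)]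
  have hμK : μ K = 0 := by
    rw [hμapp K hKc.isClosed, ← hKm, arcMeasure]
    congr 1
    ext θ
    simp [circleMap, and_comm]
  have hfin : IsFiniteMeasure μ := by
    rw [hμ]
    infer_instance
  have hlim := tendsto_measure_cthickening_of_isClosed (μ := μ)
    ⟨1, one_pos, measure_ne_top _ _⟩ hKc.isClosed
  rw [hμK] at hlim
  have hδ : Tendsto (fun N : ℕ => 2 * (2 * Real.pi / ((N : ℝ) + 1))) atTop (𝓝 0) := by
    simpa [div_eq_mul_inv, mul_assoc] using
      (tendsto_one_div_add_atTop_nhds_zero_nat (𝕜 := ℝ)).const_mul (2 * (2 * Real.pi))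
  obtain ⟨N, hN⟩ := ((hlim.comp hδ).eventually
    (gt_mem_nhds (ENNReal.ofReal_pos.2 hη))).exists
  set δ : ℝ := 2 * Real.pi / ((N : ℝ) + 1) with hδdef
  have hδ0 : 0 < δ := by positivity
  have hNδ : ((N : ℝ) + 1) * δ = 2 * Real.pi := by
    rw [hδdef]
    field_simp
  have hlip : ∀ a b : ℝ, ‖circleMap 0 1 a - circleMap 0 1 b‖ ≤ |a - b| := fun a b => by
    have := (lipschitzWith_circleMap 0 1).dist_le_mul a b
    simpa [dist_eq_norm] using this
  set T : Finset ℕ := (Finset.range (N + 1)).filter fun k =>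
    circleMap 0 1 (k * δ) ∈ cthickening δ K with hT
  refine ⟨δ, T.image fun k : ℕ => circleMap 0 1 (k * δ), hδ0, ?_, ?_, ?_⟩
  · have hsub : (⋃ k ∈ T, Ico ((k : ℝ) * δ) ((k + 1 : ℝ) * δ)) ⊆
        circleMap 0 1 ⁻¹' cthickening (2 * δ) K ∩ Ico 0 (2 * Real.pi) := by
      refine iUnion₂_subset fun k hk θ hθ => ?_
      rw [hT, Finset.mem_filter, Finset.mem_range] at hk
      have hk1 : (k : ℝ) ≤ N := by exact_mod_cast Nat.lt_succ_iff.1 hk.1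
      refine ⟨?_, le_trans (by positivity) hθ.1, hθ.2.trans_le ?_⟩
      · rw [mem_preimage, two_mul]
        refine cthickening_cthickening_subset hδ0.le hδ0.le K
          (mem_cthickening_of_dist_le _ _ _ _ hk.2 ?_)
        rw [dist_eq_norm]
        refine (hlip _ _).trans ?_
        rw [abs_of_nonneg (by linarith [hθ.1])]
        linarith [hθ.2]
      · rw [← hNδ]
        gcongr
    have hvol : volume (⋃ k ∈ T, Ico ((k : ℝ) * δ) ((k + 1 : ℝ) * δ)) =
        ENNReal.ofReal (T.card * δ) := by
      rw [measure_biUnion_finset]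
      · simp only [Real.volume_Ico]
        rw [Finset.sum_congr rfl fun k _ => by
          rw [show ((k : ℝ) + 1) * δ - k * δ = δ by ring]]
        rw [Finset.sum_const, nsmul_eq_mul, ENNReal.ofReal_mul (by positivity),
          ENNReal.ofReal_natCast]
      · have hm : Monotone fun k : ℕ => (k : ℝ) * δ := fun a b hab => by
          simp only
          gcongr
        have := hm.pairwise_disjoint_on_Ico_succ
        intro a _ b _ hab
        simpa [Function.onFun] using this hab
      · exact fun _ _ => measurableSet_Ico
    have hle := (measure_mono hsub).trans_lt (by
      rw [← hμapp _ isClosed_cthickening]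
      exact hN)
    rw [hvol, ENNReal.ofReal_lt_ofReal_iff hη] at hle
    refine le_trans ?_ hle.le
    gcongr
    exact Finset.card_image_le
  · intro w hw
    obtain ⟨k, -, rfl⟩ := Finset.mem_image.1 hw
    simp
  · intro ζ hζ
    obtain ⟨θ, hθ, rfl⟩ : ∃ θ ∈ Ico 0 (2 * Real.pi), circleMap 0 1 θ = ζ := by
      have h := hKT hζ
      rw [← abs_one (α := ℝ), ← range_circleMap] at h
      obtain ⟨t, rfl⟩ := h
      obtain ⟨θ, hθ, h⟩ := (periodic_circleMap 0 1).exists_mem_Ico₀ Real.two_pi_pos t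
      exact ⟨θ, hθ, h.symm⟩
    have hfl : (⌊θ / δ⌋₊ : ℝ) ≤ θ / δ := Nat.floor_le (div_nonneg hθ.1 hδ0.le)
    have hfl' : θ / δ < ⌊θ / δ⌋₊ + 1 := Nat.lt_floor_add_one _
    rw [le_div_iff₀ hδ0] at hfl
    rw [div_lt_iff₀ hδ0] at hfl'
    have hd : ‖circleMap 0 1 (⌊θ / δ⌋₊ * δ) - circleMap 0 1 θ‖ ≤ δ := by
      refine (hlip _ _).trans ?_
      rw [abs_le]
      constructor <;> linarith
    refine ⟨_, Finset.mem_image_of_mem _ (Finset.mem_filter.2 ⟨Finset.mem_range.2 ?_, ?_⟩), hd⟩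
    · rw [Nat.floor_lt (div_nonneg hθ.1 hδ0.le), div_lt_iff₀ hδ0]
      push_cast
      rw [hNδ]
      exact hθ.2
    · exact mem_cthickening_of_dist_le _ _ _ _ hζ (by rwa [dist_eq_norm])

lemma re_inv_pos {D : ℂ} (hD : 0 < D.re) : 0 < D⁻¹.re := by
  rw [inv_re]
  exact div_pos hD (normSq_pos.2 fun h => by simp [h] at hD)

/-- An analytic function whose values have nonnegative real part and which is at least `A / 4` on
the points close to the finite set `S`. -/
def poleSum (A δ : ℝ) (S : Finset ℂ) (z : ℂ) : ℂ :=
  A * ∑ w ∈ S, δ * (1 + δ - (starRingEnd ℂ) w * z)⁻¹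

lemma re_one_add_sub_conj_mul_ge {δ : ℝ} {w z : ℂ} (hw : ‖w‖ = 1) :
    1 + δ - ‖z‖ ≤ (1 + δ - (starRingEnd ℂ) w * z).re := by
  have h := re_le_norm ((starRingEnd ℂ) w * z)
  rw [norm_mul, RCLike.norm_conj, hw, one_mul] at h
  rw [sub_re, add_re, one_re, ofReal_re]
  linarith

lemma re_poleSum_nonneg {A δ : ℝ} (hA : 0 ≤ A) (hδ : 0 ≤ δ) {S : Finset ℂ}
    (hS : ∀ w ∈ S, ‖w‖ = 1) {z : ℂ} (hz : ‖z‖ < 1 + δ) : 0 ≤ (poleSum A δ S z).re := by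
  rw [poleSum, re_ofReal_mul, re_sum]
  refine mul_nonneg hA (Finset.sum_nonneg fun w hw => ?_)
  rw [re_ofReal_mul]
  exact mul_nonneg hδ (re_inv_pos (by linarith [re_one_add_sub_conj_mul_ge (δ := δ) (z := z) (hS w hw)])).le

lemma differentiableOn_poleSum {A δ : ℝ} {S : Finset ℂ} (hS : ∀ w ∈ S, ‖w‖ = 1) :
    DifferentiableOn ℂ (poleSum A δ S) (ball 0 (1 + δ)) := by
  refine DifferentiableOn.const_mul (DifferentiableOn.fun_sum fun w hw =>
    DifferentiableOn.const_mul (DifferentiableOn.inv (by fun_prop) fun z hz h => ?_) _) _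
  have h1 := re_one_add_sub_conj_mul_ge (δ := δ) (z := z) (hS w hw)
  rw [h, zero_re] at h1
  have hz : ‖z‖ < 1 + δ := by simpa using hz
  linarith

lemma le_re_poleSum {A δ : ℝ} (hA : 0 ≤ A) (hδ : 0 < δ) {S : Finset ℂ}
    (hS : ∀ w ∈ S, ‖w‖ = 1) {ζ : ℂ} (hζ : ‖ζ‖ = 1) {w₀ : ℂ} (hw₀ : w₀ ∈ S)
    (hd : ‖w₀ - ζ‖ ≤ δ) : A / 4 ≤ (poleSum A δ S ζ).re := by
  have hre : ∀ w ∈ S, δ ≤ (1 + δ - (starRingEnd ℂ) w * ζ).re := fun w hw => by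
    have := re_one_add_sub_conj_mul_ge (δ := δ) (z := ζ) (hS w hw)
    rw [hζ] at this
    linarith
  rw [poleSum, re_ofReal_mul, re_sum, div_eq_mul_one_div]
  refine mul_le_mul_of_nonneg_left ?_ hA
  refine le_trans ?_ (Finset.single_le_sum (fun w hw => ?_) hw₀)
  · have hw := hS w₀ hw₀
    have hnorm : ‖1 + δ - (starRingEnd ℂ) w₀ * ζ‖ ≤ 2 * δ := by
      have h1 : 1 + δ - (starRingEnd ℂ) w₀ * ζ = δ + (starRingEnd ℂ) w₀ * (w₀ - ζ) := by
        rw [mul_sub, Complex.conj_mul', hw]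
        push_cast
        ring
      rw [h1]
      refine (norm_add_le _ _).trans ?_
      rw [norm_mul, RCLike.norm_conj, hw, one_mul, norm_real, Real.norm_of_nonneg hδ.le]
      linarith
    have hpos : 0 < normSq (1 + δ - (starRingEnd ℂ) w₀ * ζ) := normSq_pos.2 fun h => by
      have := hre w₀ hw₀
      rw [h, zero_re] at this
      linarith
    rw [re_ofReal_mul, inv_re, mul_div_assoc', div_le_div_iff₀ (by norm_num) hpos,
      normSq_eq_norm_sq]
    have h2 := hre w₀ hw₀
    nlinarith [norm_nonneg (1 + δ - (starRingEnd ℂ) w₀ * ζ)]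
  · rw [re_ofReal_mul]
    exact mul_nonneg hδ.le (re_inv_pos (hδ.trans_le (hre w hw))).le

lemma norm_div_one_add_sq_le_re {q : ℂ} (hq : 0 ≤ q.re) :
    ‖q / (1 + q)‖ ^ 2 ≤ (q / (1 + q)).re := by
  have hpos : 0 < normSq (1 + q) := normSq_pos.2 fun h => by
    have := congrArg re h
    simp at this
    linarith
  rw [norm_div, div_pow, ← normSq_eq_norm_sq, ← normSq_eq_norm_sq, div_re, ← add_div]
  refine div_le_div_of_nonneg_right ?_ hpos.le
  simp [normSq_apply]
  nlinarith

lemma exists_polynomial_near_one {K : Set ℂ} (hKc : IsCompact K)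
    (hKT : K ⊆ sphere (0 : ℂ) 1) (hKm : arcMeasure K = 0) {p : ℝ} (hp : 1 ≤ p)
    {ε : ℝ} (hε : 0 < ε) :
    ∃ χ : ℂ[X], (∀ ζ ∈ K, ‖χ.eval ζ - 1‖ ≤ ε) ∧ circleMeanPow p (fun z => χ.eval z) ≤ ε := by
  set A : ℝ := 8 / ε with hA
  have hA0 : 0 < A := by positivity
  set κ : ℝ := ε / (2 * 2 ^ p) with hκ
  have h2p : (0 : ℝ) < 2 ^ p := by positivity
  have hκ0 : 0 < κ := by positivity
  obtain ⟨δ, S, hδ, hcard, hS, hcov⟩ := exists_finset_cover_card_mul_le hKc hKT hKm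
    (η := κ ^ 2 / A) (by positivity)
  set q := poleSum A δ S with hq
  have hqre : ∀ z ∈ ball (0 : ℂ) (1 + δ), 0 ≤ (q z).re := fun z hz =>
    re_poleSum_nonneg hA0.le hδ.le hS (by simpa using hz)
  have hne : ∀ z ∈ ball (0 : ℂ) (1 + δ), 1 + q z ≠ 0 := fun z hz h => by
    have := congrArg re h
    simp at this
    linarith [hqre z hz]
  set χ : ℂ → ℂ := fun z => q z / (1 + q z) with hχ
  have hqd : DifferentiableOn ℂ q (ball 0 (1 + δ)) := differentiableOn_poleSum hS
  have hχd : DifferentiableOn ℂ χ (ball 0 (1 + δ)) := hqd.div (hqd.const_add 1) hne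
  have hsub : closedBall (0 : ℂ) 1 ⊆ ball 0 (1 + δ) := closedBall_subset_ball (by linarith)
  have hχ1 : DiffContOnCl ℂ χ (ball 0 1) :=
    (hχd.mono (by rwa [closure_ball _ one_ne_zero])).diffContOnCl
  have hχs := hχ1.continuousOn_sphere
  have hsq : ∀ z ∈ closedBall (0 : ℂ) 1, ‖χ z‖ ^ 2 ≤ (χ z).re := fun z hz =>
    norm_div_one_add_sq_le_re (hqre z (hsub hz))
  have hle1 : ∀ z ∈ closedBall (0 : ℂ) 1, ‖χ z‖ ≤ 1 := fun z hz => by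
    have h1 := hsq z hz
    have h2 := re_le_norm (χ z)
    nlinarith [norm_nonneg (χ z)]
  have hmean2 : circleMeanPow 2 χ ≤ κ ^ 2 := by
    have h1 : circleMeanPow 2 χ ≤ Real.circleAverage (reCLM ∘ χ) 0 1 := by
      simp only [circleMeanPow, Real.rpow_two]
      exact circleAverage_unit_mono (hχs.norm.pow 2) (reCLM.continuous.comp_continuousOn hχs)
        fun z hz => hsq z (sphere_subset_closedBall hz)
    rw [Complex.reCLM.circleAverage_comp_comm (circleIntegrable_of_continuousOn_sphere hχs),
      DiffContOnCl.circleAverage (by simpa using hχ1)] at h1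
    refine h1.trans ?_
    have hq0 : q 0 = ((A * (S.card * (δ * (1 + δ)⁻¹)) : ℝ) : ℂ) := by
      simp [hq, poleSum]
    have hc0 : 0 ≤ A * (S.card * (δ * (1 + δ)⁻¹)) := by positivity
    have hc1 : A * (S.card * (δ * (1 + δ)⁻¹)) ≤ κ ^ 2 := by
      calc A * (S.card * (δ * (1 + δ)⁻¹)) ≤ A * (S.card * (δ * 1)) := by
            gcongr
            exact inv_le_one_of_one_le₀ (by linarith)
        _ ≤ A * (κ ^ 2 / A) := by
            rw [mul_one]
            gcongr
        _ = κ ^ 2 := by field_simp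
    simp only [hχ, hq0, reCLM_apply]
    rw [← ofReal_one, ← ofReal_add, ← ofReal_div, ofReal_re]
    exact (div_le_self hc0 (by linarith)).trans hc1
  have hmean1 : circleMeanPow 1 χ ≤ κ := by
    have h := circleMeanPow_one_mul_le hχs (continuousOn_const (c := (1 : ℂ)))
    have h1 : circleMeanPow 2 (fun _ => (1 : ℂ)) = 1 := by
      simp [circleMeanPow, Real.circleAverage_const]
    rw [h1, mul_one] at h
    simp only [mul_one] at h
    exact h.trans (Real.sqrt_le_iff.2 ⟨hκ0.le, hmean2⟩)
  obtain ⟨Q, hQ⟩ := exists_polynomial_approx (by linarith : 1 < 1 + δ) hχd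
    (ε := min 1 (min (ε / 2) κ)) (by positivity)
  refine ⟨Q, fun ζ hζ => ?_, ?_⟩
  · have hζs := hKT hζ
    have hζn : ‖ζ‖ = 1 := by simpa using hζs
    have hζc := sphere_subset_closedBall hζs
    obtain ⟨w, hw, hwd⟩ := hcov ζ hζ
    have h1 : A / 4 ≤ (q ζ).re := le_re_poleSum hA0.le hδ hS hζn hw hwd
    have h2 : A / 4 ≤ ‖1 + q ζ‖ := by
      refine le_trans ?_ (re_le_norm _)
      simp only [add_re, one_re]
      linarith
    have h3 : ‖χ ζ - 1‖ ≤ ε / 2 := by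
      have : χ ζ - 1 = -(1 + q ζ)⁻¹ := by
        have := hne ζ (hsub hζc)
        simp only [hχ]
        field_simp
        ring
      rw [this, norm_neg, norm_inv]
      calc ‖1 + q ζ‖⁻¹ ≤ (A / 4)⁻¹ := inv_anti₀ (by positivity) h2
        _ = ε / 2 := by
          rw [hA]
          field_simp
          norm_num
    have h4 := (hQ ζ hζc).le.trans ((min_le_right _ _).trans (min_le_left _ _))
    rw [norm_sub_rev] at h4
    have := norm_add_le (Q.eval ζ - χ ζ) (χ ζ - 1)
    rw [sub_add_sub_cancel] at this
    linarith
  · have hQs : ContinuousOn (fun z => Q.eval z) (sphere 0 1) := by fun_prop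
    have hpt : ∀ z ∈ sphere (0 : ℂ) 1, ‖Q.eval z‖ ^ p ≤ (2 : ℝ) ^ p • (‖χ z‖ + κ) := by
      intro z hz
      have hz := sphere_subset_closedBall hz
      have h1 := (hQ z hz).le
      rw [norm_sub_rev] at h1
      have h2 : ‖Q.eval z‖ ≤ ‖Q.eval z - χ z‖ + ‖χ z‖ := by
        simpa using norm_add_le (Q.eval z - χ z) (χ z)
      set m := max (‖Q.eval z - χ z‖) ‖χ z‖ with hm
      have hm0 : 0 ≤ m := (norm_nonneg _).trans (le_max_right _ _)
      have hm1 : m ≤ 1 := max_le (h1.trans (min_le_left _ _)) (hle1 z hz)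
      have hm2 : m ≤ ‖χ z‖ + κ := max_le
        ((h1.trans ((min_le_right _ _).trans (min_le_right _ _))).trans
          (le_add_of_nonneg_left (norm_nonneg _))) (le_add_of_nonneg_right hκ0.le)
      have h3 : ‖Q.eval z‖ ≤ 2 * m := by
        linarith [le_max_left (‖Q.eval z - χ z‖) ‖χ z‖, le_max_right (‖Q.eval z - χ z‖) ‖χ z‖]
      calc ‖Q.eval z‖ ^ p ≤ (2 * m) ^ p := by gcongr
        _ = 2 ^ p * m ^ p := Real.mul_rpow zero_le_two hm0
        _ ≤ 2 ^ p * m := by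
          gcongr
          exact Real.rpow_le_self_of_le_one hm0 hm1 hp
        _ ≤ (2 : ℝ) ^ p • (‖χ z‖ + κ) := by
          rw [smul_eq_mul]
          gcongr
    have h1 : circleMeanPow p (fun z => Q.eval z) ≤
        Real.circleAverage (fun z => (2 : ℝ) ^ p • (‖χ z‖ + κ)) 0 1 :=
      circleAverage_unit_mono (continuousOn_norm_rpow (by linarith) hQs)
        ((hχs.norm.add continuousOn_const).const_smul ((2 : ℝ) ^ p)) hpt
    rw [Real.circleAverage_fun_smul, Real.circleAverage_fun_add
      (circleIntegrable_of_continuousOn_sphere hχs.norm)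
      (circleIntegrable_of_continuousOn_sphere continuousOn_const),
      Real.circleAverage_const, smul_eq_mul] at h1
    simp only [circleMeanPow, Real.rpow_one] at hmean1
    refine h1.trans ?_
    calc 2 ^ p * (Real.circleAverage (fun z => ‖χ z‖) 0 1 + κ) ≤ 2 ^ p * (κ + κ) := by gcongr
      _ = ε := by
        rw [hκ]
        field_simp
        norm_num

lemma intervalIntegral_unit_rpow_le {p : ℝ} (hp : 1 ≤ p) {v : ℝ → ℝ} (hv : Continuous v)
    (hv0 : ∀ s, 0 ≤ v s) : (∫ s in (0 : ℝ)..1, v s) ^ p ≤ ∫ s in (0 : ℝ)..1, v s ^ p := by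
  have hp0 : 0 ≤ p := by linarith
  have hprob : IsProbabilityMeasure (volume.restrict (Ioc (0 : ℝ) 1)) := ⟨by simp⟩
  have hvp : Continuous fun s => v s ^ p := hv.rpow_const fun _ => Or.inr hp0
  have := (convexOn_rpow hp).map_integral_le (μ := volume.restrict (Ioc (0 : ℝ) 1)) (f := v)
    (Real.continuous_rpow_const hp0).continuousOn isClosed_Ici
    (Eventually.of_forall fun s => hv0 s)
    (hv.intervalIntegrable 0 1).1 (hvp.intervalIntegrable 0 1).1
  simpa [intervalIntegral.integral_of_le zero_le_one] using this

lemma eval_eq_mul_integral_derivative {h : ℂ[X]} (h0 : h.eval 0 = 0) (z : ℂ) :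
    h.eval z = z * ∫ s in (0 : ℝ)..1, (derivative h).eval (s * z) := by
  have hd : ∀ s ∈ uIcc (0 : ℝ) 1,
      HasDerivAt (fun s : ℝ => h.eval (s * z)) ((derivative h).eval (s * z) * z) s := fun s _ => by
    have h1 : HasDerivAt (fun s : ℝ => (s : ℂ) * z) z s := by
      simpa using (Complex.ofRealCLM.hasDerivAt (x := s)).mul_const z
    exact (h.hasDerivAt (s * z)).comp s h1
  have := intervalIntegral.integral_eq_sub_of_hasDerivAt hd
    (Continuous.intervalIntegrable (by fun_prop) _ _)
  rw [intervalIntegral.integral_mul_const] at this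
  rw [mul_comm, this]
  simp [h0]

lemma exists_derivative_eq (u : ℂ[X]) : ∃ h : ℂ[X], derivative h = u ∧ h.eval 0 = 0 := by
  induction u using Polynomial.induction_on' with
  | add u v hu hv =>
    obtain ⟨h, rfl, h0⟩ := hu
    obtain ⟨k, rfl, k0⟩ := hv
    exact ⟨h + k, by simp, by simp [h0, k0]⟩
  | monomial n a =>
    refine ⟨monomial (n + 1) (a / (n + 1)), ?_, by simp⟩
    rw [derivative_monomial]
    have : (n : ℂ) + 1 ≠ 0 := by exact_mod_cast n.succ_ne_zero
    simp [div_mul_cancel₀ _ this]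

lemma circleMeanPow_le_derivative {p : ℝ} (hp : 1 ≤ p) {h : ℂ[X]} (h0 : h.eval 0 = 0) :
    circleMeanPow p (fun z => h.eval z) ≤ circleMeanPow p fun z => (derivative h).eval z := by
  have hp0 : 0 ≤ p := by linarith
  set u := derivative h with hu
  have hpt : ∀ z ∈ sphere (0 : ℂ) 1,
      ‖h.eval z‖ ^ p ≤ ∫ s in (0 : ℝ)..1, ‖u.eval (s * z)‖ ^ p := fun z hz => by
    have hz : ‖z‖ = 1 := by simpa using hz
    refine le_trans ?_ (intervalIntegral_unit_rpow_le hp (v := fun s => ‖u.eval (s * z)‖)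
      (by fun_prop) fun _ => norm_nonneg _)
    rw [eval_eq_mul_integral_derivative h0, norm_mul, hz, one_mul]
    exact Real.rpow_le_rpow (norm_nonneg _)
      (intervalIntegral.norm_integral_le_integral_norm zero_le_one) hp0
  have hcont : Continuous fun x : ℂ × ℝ => ‖u.eval (x.2 * x.1)‖ ^ p :=
    Continuous.rpow_const (by fun_prop) fun _ => Or.inr hp0
  have hint : Continuous fun z : ℂ => ∫ s in (0 : ℝ)..1, ‖u.eval (s * z)‖ ^ p :=
    intervalIntegral.continuous_parametric_intervalIntegral_of_continuous' (μ := volume)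
      (f := fun (z : ℂ) (s : ℝ) => ‖u.eval (s * z)‖ ^ p) hcont 0 1
  have hswap : Real.circleAverage (fun z => ∫ s in (0 : ℝ)..1, ‖u.eval (s * z)‖ ^ p) 0 1 =
      ∫ s in (0 : ℝ)..1, circleMeanPow p fun z => u.eval (s * z) := by
    simp only [circleMeanPow, Real.circleAverage_def, intervalIntegral.integral_smul]
    rw [intervalIntegral_intervalIntegral_swap]
    have hc : Continuous fun x : ℝ × ℝ => ‖u.eval (x.2 * circleMap 0 1 x.1)‖ ^ p :=
      Continuous.rpow_const (by fun_prop) fun _ => Or.inr hp0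
    exact (hc.continuousOn.integrableOn_compact (isCompact_uIcc.prod isCompact_uIcc)).mono_set
      (Set.prod_mono uIoc_subset_uIcc uIoc_subset_uIcc)
  have hud : DiffContOnCl ℂ (fun z => u.eval z) (ball 0 1) :=
    (Polynomial.differentiable u).diffContOnCl
  refine (circleAverage_unit_mono (u := fun z => ‖h.eval z‖ ^ p)
    (continuousOn_norm_rpow hp0 (by fun_prop)) hint.continuousOn
    hpt).trans ?_
  rw [hswap]
  have hle : ∫ s in (0 : ℝ)..1, circleMeanPow p (fun z => u.eval (s * z)) ≤
      ∫ _ in (0 : ℝ)..1, circleMeanPow p fun z => u.eval z := by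
    refine intervalIntegral.integral_mono_on_of_le_Ioo zero_le_one ?_ (by simp) fun s hs =>
      circleMeanPow_dilate_le hp hud hs.1.le hs.2
    refine Continuous.intervalIntegrable ?_ _ _
    have hc : Continuous fun x : ℝ × ℝ => ‖u.eval (x.1 * circleMap 0 1 x.2)‖ ^ p :=
      Continuous.rpow_const (by fun_prop) fun _ => Or.inr hp0
    have hi := intervalIntegral.continuous_parametric_intervalIntegral_of_continuous' (μ := volume)
      (f := fun s θ : ℝ => ‖u.eval (s * circleMap 0 1 θ)‖ ^ p) hc 0 (2 * Real.pi)
    exact hi.const_smul (2 * Real.pi)⁻¹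
  simpa using hle

lemma exists_iterate_derivative_eq {p : ℝ} (hp : 1 ≤ p) (l : ℕ) (u : ℂ[X]) :
    ∃ h : ℂ[X], derivative^[l] h = u ∧
      circleMeanPow p (fun z => h.eval z) ≤ circleMeanPow p fun z => u.eval z := by
  induction l generalizing u with
  | zero => exact ⟨u, rfl, le_rfl⟩
  | succ l ih =>
    obtain ⟨v, rfl, hv⟩ := exists_derivative_eq u
    obtain ⟨h, rfl, hh⟩ := ih v
    exact ⟨h, Function.iterate_succ_apply' _ _ _, hh.trans (circleMeanPow_le_derivative hp hv)⟩

lemma circleMeanPow_add_le {p : ℝ} (hp : 1 ≤ p) {F G : ℂ → ℂ}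
    (hF : ContinuousOn F (sphere 0 1)) (hG : ContinuousOn G (sphere 0 1)) {a b : ℝ}
    (ha : 0 < a) (hb : 0 < b) (hFa : circleMeanPow p F ≤ a ^ p)
    (hGb : circleMeanPow p G ≤ b ^ p) :
    circleMeanPow p (fun z => F z + G z) ≤ (a + b) ^ p := by
  have hp0 : 0 ≤ p := by linarith
  have hab : 0 < a + b := add_pos ha hb
  have hpt : ∀ z ∈ sphere (0 : ℂ) 1, ‖F z + G z‖ ^ p ≤
      ((a + b) ^ p * (a / (a + b)) / a ^ p) • ‖F z‖ ^ p +
        ((a + b) ^ p * (b / (a + b)) / b ^ p) • ‖G z‖ ^ p := fun z _ => by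
    have hconv := (convexOn_rpow hp).2 (mem_Ici.2 (by positivity : 0 ≤ ‖F z‖ / a))
      (mem_Ici.2 (by positivity : 0 ≤ ‖G z‖ / b)) (by positivity : 0 ≤ a / (a + b))
      (by positivity : 0 ≤ b / (a + b)) (by field_simp)
    simp only [smul_eq_mul] at hconv ⊢
    have he : a / (a + b) * (‖F z‖ / a) + b / (a + b) * (‖G z‖ / b) =
        (‖F z‖ + ‖G z‖) / (a + b) := by field_simp
    rw [he, Real.div_rpow (by positivity) hab.le, Real.div_rpow (by positivity) ha.le,
      Real.div_rpow (by positivity) hb.le, div_le_iff₀ (by positivity)] at hconv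
    calc ‖F z + G z‖ ^ p ≤ (‖F z‖ + ‖G z‖) ^ p := by
          gcongr
          exact norm_add_le _ _
      _ ≤ _ := hconv
      _ = _ := by ring
  have hFp := continuousOn_norm_rpow hp0 hF
  have hGp := continuousOn_norm_rpow hp0 hG
  have hFp' : ContinuousOn (fun z => ((a + b) ^ p * (a / (a + b)) / a ^ p) • ‖F z‖ ^ p)
      (sphere 0 1) := hFp.const_smul ((a + b) ^ p * (a / (a + b)) / a ^ p)
  have hGp' : ContinuousOn (fun z => ((a + b) ^ p * (b / (a + b)) / b ^ p) • ‖G z‖ ^ p)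
      (sphere 0 1) := hGp.const_smul ((a + b) ^ p * (b / (a + b)) / b ^ p)
  refine (circleAverage_unit_mono (u := fun z => ‖F z + G z‖ ^ p)
    (continuousOn_norm_rpow hp0 (hF.add hG))
    (hFp'.add hGp') hpt).trans ?_
  simp only [Pi.add_def]
  rw [Real.circleAverage_fun_add (circleIntegrable_of_continuousOn_sphere hFp')
    (circleIntegrable_of_continuousOn_sphere hGp'),
    Real.circleAverage_fun_smul, Real.circleAverage_fun_smul, smul_eq_mul, smul_eq_mul]
  calc _ ≤ (a + b) ^ p * (a / (a + b)) / a ^ p * a ^ p +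
        (a + b) ^ p * (b / (a + b)) / b ^ p * b ^ p := by
        gcongr
        · exact hFa
        · exact hGb
    _ = (a + b) ^ p := by field_simp

lemma circleMeanPow_sub_comm (p : ℝ) (F G : ℂ → ℂ) :
    circleMeanPow p (fun z => F z - G z) = circleMeanPow p fun z => G z - F z := by
  simp only [circleMeanPow, norm_sub_rev]

lemma hardyMean_eq_circleMeanPow (p : ℝ) (f : ℂ → ℂ) (r : ℝ) :
    1 / (2 * Real.pi) * ∫ θ in (0 : ℝ)..(2 * Real.pi), ‖f (r * exp (θ * I))‖ ^ p =
      circleMeanPow p fun z => f (r * z) := by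
  simp [circleMeanPow, Real.circleAverage_def, circleMap]

lemma rpow_one_div_le_iff {p : ℝ} (hp : 1 ≤ p) {x c : ℝ} (hx : 0 ≤ x) (hc : 0 ≤ c) :
    x ^ (1 / p) ≤ c ↔ x ≤ c ^ p := by
  rw [one_div]
  exact Real.rpow_inv_le_iff_of_pos hx hc (by linarith)

lemma hardyNorm_le {p : ℝ} (hp : 1 ≤ p) {f : ℂ → ℂ} {c : ℝ} (hc : 0 ≤ c)
    (h : ∀ r ∈ Ioo (0 : ℝ) 1, circleMeanPow p (fun z => f (r * z)) ≤ c ^ p) :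
    hardyNorm p f ≤ c := by
  refine Real.iSup_le (fun r => ?_) hc
  rw [hardyMean_eq_circleMeanPow, rpow_one_div_le_iff hp (circleMeanPow_nonneg _ _) hc]
  exact h r r.2

lemma hardyNorm_nonneg (p : ℝ) (f : ℂ → ℂ) : 0 ≤ hardyNorm p f :=
  Real.iSup_nonneg fun r => by
    rw [hardyMean_eq_circleMeanPow]
    exact Real.rpow_nonneg (circleMeanPow_nonneg _ _) _

lemma circleMeanPow_dilate_le_of_hardyNorm_le {p : ℝ} (hp : 1 ≤ p) {f : ℂ → ℂ}
    (hf : MemHp p f) {c : ℝ} (hc : hardyNorm p f ≤ c) {r : ℝ} (hr : r ∈ Ioo (0 : ℝ) 1) :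
    circleMeanPow p (fun z => f (r * z)) ≤ c ^ p := by
  rw [← rpow_one_div_le_iff hp (circleMeanPow_nonneg _ _) ((hardyNorm_nonneg p f).trans hc),
    ← hardyMean_eq_circleMeanPow]
  exact (le_ciSup hf.2 ⟨r, hr⟩).trans hc

lemma memHp_of_circleMeanPow_le {p : ℝ} (hp : 1 ≤ p) {f : ℂ → ℂ}
    (hf : DifferentiableOn ℂ f (ball 0 1)) {c : ℝ} (hc : 0 ≤ c)
    (h : ∀ r ∈ Ioo (0 : ℝ) 1, circleMeanPow p (fun z => f (r * z)) ≤ c ^ p) : MemHp p f := by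
  refine ⟨hf, c, ?_⟩
  rintro _ ⟨r, rfl⟩
  simp only
  rw [hardyMean_eq_circleMeanPow, rpow_one_div_le_iff hp (circleMeanPow_nonneg _ _) hc]
  exact h r r.2

lemma DifferentiableOn.continuousOn_dilate_sphere {f : ℂ → ℂ}
    (hf : DifferentiableOn ℂ f (ball 0 1)) {r : ℝ} (hr : r ∈ Ioo (0 : ℝ) 1) :
    ContinuousOn (fun z => f (r * z)) (sphere 0 1) :=
  (hf.diffContOnCl_dilate hr.1 hr.2).continuousOn_sphere

lemma MemHp.sub {p : ℝ} (hp : 1 ≤ p) {f g : ℂ → ℂ} (hf : MemHp p f) (hg : MemHp p g) :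
    MemHp p fun z => f z - g z := by
  have hf0 := hardyNorm_nonneg p f
  have hg0 := hardyNorm_nonneg p g
  refine memHp_of_circleMeanPow_le hp (hf.1.sub hg.1)
    (c := (hardyNorm p f + 1) + (hardyNorm p g + 1)) (by positivity) fun r hr => ?_
  have h1 := circleMeanPow_dilate_le_of_hardyNorm_le hp hf (lt_add_one _).le hr
  have h2 := circleMeanPow_dilate_le_of_hardyNorm_le hp hg (lt_add_one _).le hr
  simpa only [sub_eq_add_neg] using circleMeanPow_add_le hp (G := fun z => -g (r * z))
    (hf.1.continuousOn_dilate_sphere hr) (hg.1.continuousOn_dilate_sphere hr).neg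
    (by positivity) (by positivity) h1 (by simpa [circleMeanPow] using h2)

lemma exists_circleMeanPow_sub_le_imp_mem {p : ℝ} (hp : 1 ≤ p) {V : Set (HpSpace p)}
    (hV : IsOpen V) {f : HpSpace p} (hfV : f ∈ V) :
    ∃ ε > 0, ∀ g : HpSpace p,
      (∀ r ∈ Ioo (0 : ℝ) 1, circleMeanPow p (fun z => g.1 (r * z) - f.1 (r * z)) ≤ ε ^ p) →
        g ∈ V := by
  induction hV with
  | basic V hV =>
    obtain ⟨k, ε, -, rfl⟩ := hV
    obtain ⟨a, ha, haε⟩ := exists_between (mem_ofPred.1 hfV)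
    obtain ⟨b, hb, hbε⟩ := exists_between (sub_pos.2 haε)
    have ha0 := (hardyNorm_nonneg p _).trans_lt ha
    refine ⟨b, hb, fun g hg => ?_⟩
    refine mem_ofPred.2 (lt_of_le_of_lt (hardyNorm_le hp (add_pos ha0 hb).le fun r hr => ?_)
      (by linarith : a + b < ε))
    have h1 := circleMeanPow_dilate_le_of_hardyNorm_le hp (f.2.sub hp k.2) ha.le hr
    have hc := fun u : HpSpace p => u.2.1.continuousOn_dilate_sphere hr
    simpa using circleMeanPow_add_le hp ((hc f).sub (hc k)) ((hc g).sub (hc f)) ha0 hb h1 (hg r hr)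
  | univ => exact ⟨1, one_pos, fun _ _ => mem_univ _⟩
  | inter U V _ _ hU hV =>
    obtain ⟨a, ha, hUa⟩ := hU hfV.1
    obtain ⟨b, hb, hVb⟩ := hV hfV.2
    have hm : 0 < min a b := lt_min ha hb
    refine ⟨min a b, hm, fun g hg => ⟨hUa g fun r hr => ?_, hVb g fun r hr => ?_⟩⟩
    · exact (hg r hr).trans (Real.rpow_le_rpow hm.le (min_le_left _ _) (by linarith))
    · exact (hg r hr).trans (Real.rpow_le_rpow hm.le (min_le_right _ _) (by linarith))
  | sUnion S _ ih =>
    obtain ⟨U, hU, hfU⟩ := hfV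
    obtain ⟨ε, hε, h⟩ := ih U hU hfU
    exact ⟨ε, hε, fun g hg => ⟨U, hU, h g hg⟩⟩

lemma iteratedDeriv_polynomial_eval (l : ℕ) (q : ℂ[X]) :
    iteratedDeriv l (fun z => q.eval z) = fun z => (derivative^[l] q).eval z := by
  induction l with
  | zero => simp
  | succ l ih =>
    rw [iteratedDeriv_succ, ih, Function.iterate_succ_apply']
    ext z
    exact Polynomial.deriv _

lemma exists_norm_eval_le (q : ℂ[X]) :
    ∃ c > 0, ∀ z ∈ closedBall (0 : ℂ) 1, ‖q.eval z‖ ≤ c := by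
  obtain ⟨c, hc⟩ := (isCompact_closedBall (0 : ℂ) 1).exists_bound_of_continuousOn
    (f := fun z => q.eval z) (by fun_prop)
  exact ⟨max c 1, by positivity, fun z hz => (hc z hz).trans (le_max_left _ _)⟩

lemma memHp_polynomial_eval {p : ℝ} (hp : 1 ≤ p) (q : ℂ[X]) : MemHp p fun z => q.eval z := by
  obtain ⟨c, hc, hq⟩ := exists_norm_eval_le q
  refine memHp_of_circleMeanPow_le hp (by fun_prop) hc.le fun r hr =>
    circleMeanPow_le_of_norm_le (by linarith) (by fun_prop) fun z hz => hq _ ?_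
  exact mapsTo_ofReal_mul_closedBall hr.1.le hr.2.le (sphere_subset_closedBall hz)

/-- Polynomials whose `l`-th derivative is close to a prescribed polynomial on `K` are dense. -/
lemma exists_polynomial_approx_iterate_derivative {p : ℝ} (hp : 1 ≤ p) {K : Set ℂ}
    (hKc : IsCompact K) (hKT : K ⊆ sphere (0 : ℂ) 1) (hKm : arcMeasure K = 0) {f : ℂ → ℂ}
    (hf : MemHp p f) (Q : ℂ[X]) (l : ℕ) {ε η : ℝ} (hε : 0 < ε) (hη : 0 < η) :
    ∃ G : ℂ[X], (∀ r ∈ Ioo (0 : ℝ) 1,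
        circleMeanPow p (fun z => G.eval (r * z) - f (r * z)) ≤ ε ^ p) ∧
      ∀ ζ ∈ K, ‖(derivative^[l] G).eval ζ - Q.eval ζ‖ ≤ η := by
  have hp0 : 0 ≤ p := by linarith
  have hε3 : 0 < ε / 3 := by positivity
  have hbdd : BddAbove ((fun r : ℝ => circleMeanPow p fun z => f (r * z)) '' Ioo 0 1) := by
    refine ⟨hardyNorm p f ^ p, ?_⟩
    rintro _ ⟨r, hr, rfl⟩
    exact circleMeanPow_dilate_le_of_hardyNorm_le hp hf le_rfl hr
  obtain ⟨t, ht, hft⟩ := exists_circleMeanPow_sub_dilate_le hp hf.1 hbdd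
    (Real.rpow_pos_of_pos hε3 p)
  have hft_diff : DifferentiableOn ℂ (fun z => f (t * z)) (ball 0 (1 / t)) :=
    hf.1.dilate_of_pos ht.1
  obtain ⟨q, hq⟩ := exists_polynomial_approx (one_lt_one_div ht.1 ht.2) hft_diff hε3
  set φ : ℂ[X] := Q - derivative^[l] q with hφ
  obtain ⟨c, hc, hφc⟩ := exists_norm_eval_le φ
  obtain ⟨χ, hχK, hχm⟩ := exists_polynomial_near_one hKc hKT hKm hp
    (ε := min (η / c) ((ε / 3 / c) ^ p)) (by positivity)
  obtain ⟨h, hh, hhm⟩ := exists_iterate_derivative_eq hp l (φ * χ)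
  have hφχ : circleMeanPow p (fun z => (φ * χ).eval z) ≤ (ε / 3) ^ p := by
    have hpt : ∀ z ∈ sphere (0 : ℂ) 1, ‖(φ * χ).eval z‖ ^ p ≤ c ^ p • ‖χ.eval z‖ ^ p :=
      fun z hz => by
        rw [eval_mul, norm_mul, Real.mul_rpow (norm_nonneg _) (norm_nonneg _), smul_eq_mul]
        gcongr
        exact hφc z (sphere_subset_closedBall hz)
    have hχp : ContinuousOn (fun z => ‖χ.eval z‖ ^ p) (sphere 0 1) :=
      continuousOn_norm_rpow hp0 (by fun_prop)
    refine (circleAverage_unit_mono (continuousOn_norm_rpow hp0 (by fun_prop))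
      (hχp.const_smul (c ^ p)) hpt).trans ?_
    simp only [Pi.smul_def]
    rw [Real.circleAverage_fun_smul, smul_eq_mul]
    calc c ^ p * circleMeanPow p (fun z => χ.eval z) ≤ c ^ p * (ε / 3 / c) ^ p := by
          gcongr
          exact hχm.trans (min_le_right _ _)
      _ = (ε / 3) ^ p := by
          rw [← Real.mul_rpow hc.le (by positivity), mul_div_cancel₀ _ hc.ne']
  refine ⟨q + h, fun r hr => ?_, fun ζ hζ => ?_⟩
  · have hmaps := fun z (hz : z ∈ sphere (0 : ℂ) 1) =>
      mapsTo_ofReal_mul_closedBall hr.1.le hr.2.le (sphere_subset_closedBall hz)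
    have hfr := hf.1.continuousOn_dilate_sphere hr
    have hftr : ContinuousOn (fun z => f (t * (r * z))) (sphere 0 1) :=
      (hf.1.dilate ht.1.le ht.2.le).continuousOn_dilate_sphere hr
    have h1 : circleMeanPow p (fun z => h.eval (r * z)) ≤ (ε / 3) ^ p :=
      (circleMeanPow_dilate_le hp h.differentiable.diffContOnCl hr.1.le hr.2).trans
        (hhm.trans hφχ)
    have h2 : circleMeanPow p (fun z => q.eval (r * z) - f (t * (r * z))) ≤ (ε / 3) ^ p := by
      refine circleMeanPow_le_of_norm_le hp0 (ContinuousOn.sub (by fun_prop) hftr) fun z hz => ?_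
      rw [norm_sub_rev]
      exact (hq _ (hmaps z hz)).le
    have h3 := hft r hr
    rw [circleMeanPow_sub_comm] at h3
    have h12 := circleMeanPow_add_le hp (by fun_prop) (ContinuousOn.sub (by fun_prop) hftr)
      hε3 hε3 h1 h2
    have h123 := circleMeanPow_add_le hp (ContinuousOn.add (by fun_prop)
      (ContinuousOn.sub (by fun_prop) hftr)) (hftr.sub hfr) (add_pos hε3 hε3) hε3 h12 h3
    convert h123 using 2
    · ext z
      simp only [Pi.add_apply, Pi.sub_apply, eval_add]
      ring
    · ring
  · have hζs := sphere_subset_closedBall (hKT hζ)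
    have : (derivative^[l] (q + h)).eval ζ - Q.eval ζ = φ.eval ζ * (χ.eval ζ - 1) := by
      rw [iterate_map_add, hh, hφ]
      simp only [eval_add, eval_mul, eval_sub]
      ring
    rw [this, norm_mul]
    calc ‖φ.eval ζ‖ * ‖χ.eval ζ - 1‖ ≤ c * (η / c) :=
          mul_le_mul (hφc ζ hζs) ((hχK ζ hζ).trans (min_le_left _ _)) (norm_nonneg _) hc.le
      _ = η := mul_div_cancel₀ _ hc.ne'

/-- Lemma (hardyderdense2): each `⋃_{r∈ρ} U(j,s,l,r)` is dense in `H^p(𝔻)`. -/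
theorem statement_14 (p : ℝ) (hp : 1 ≤ p)
    (ρ : Set ℝ) (hρ : ρ ⊆ Set.Ico (0:ℝ) 1) (hρ1 : AccPt (1:ℝ) (Filter.principal ρ))
    (K : Set ℂ) (hKc : IsCompact K) (hKT : K ⊆ Metric.sphere (0:ℂ) 1)
    (hKm : arcMeasure K = 0)
    (P : ℕ → Polynomial ℂ) (hP1 : ∀ j, RatPoly (P j))
    (hP2 : ∀ q : Polynomial ℂ, RatPoly q → ∃ j, P j = q)
    (j l s : ℕ) (hs : 1 ≤ s) :
    Dense (⋃ r ∈ ρ, UHpD p K P j s l r) := by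
  refine dense_iff_inter_open.2 fun V hV ⟨f, hfV⟩ => ?_
  obtain ⟨ε, hε, hεV⟩ := exists_circleMeanPow_sub_le_imp_mem hp hV hfV
  have hs0 : (0 : ℝ) < s := by exact_mod_cast hs
  have hη : 0 < 1 / (s : ℝ) / 4 := by positivity
  obtain ⟨G, hGf, hGK⟩ := exists_polynomial_approx_iterate_derivative hp hKc hKT hKm f.2 (P j) l
    hε hη
  have huc : UniformContinuousOn (fun z => (derivative^[l] G).eval z) (closedBall (0 : ℂ) 1) :=
    (isCompact_closedBall 0 1).uniformContinuousOn_of_continuous (by fun_prop)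
  obtain ⟨δ, hδ, hGδ⟩ := Metric.uniformContinuousOn_iff.1 huc _ hη
  obtain ⟨r, ⟨hrδ, hrρ⟩, -⟩ := accPt_iff_nhds.1 hρ1 (ball 1 (δ / 2)) (ball_mem_nhds _ (by positivity))
  obtain ⟨hr0, hr1⟩ := hρ hrρ
  have hrδ : 1 - r < δ / 2 := by
    have := (abs_lt.1 (by simpa [Real.dist_eq] using hrδ : |r - 1| < δ / 2)).1
    linarith
  refine ⟨⟨_, memHp_polynomial_eval hp G⟩, hεV _ hGf, mem_iUnion₂.2 ⟨r, hrρ, ?_⟩⟩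
  have hbound : ∀ ζ ∈ K, ∀ z ∈ closedBall (0 : ℂ) (s / (s + 1)),
      ‖(derivative^[l] G).eval (r * (ζ - z) + z) - (P j).eval ζ‖ ≤ 1 / (s : ℝ) / 2 := by
    intro ζ hζ z hz
    have hζ1 : ‖ζ‖ = 1 := by simpa using hKT hζ
    have hz1 : ‖z‖ ≤ 1 := (mem_closedBall_zero_iff.1 hz).trans
      ((div_le_one (by positivity)).2 (by linarith))
    have hr1' : ‖(1 : ℂ) - r‖ = 1 - r := by
      rw [← ofReal_one, ← ofReal_sub, norm_real, Real.norm_of_nonneg (by linarith)]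
    have hw : r * (ζ - z) + z ∈ closedBall (0 : ℂ) 1 := by
      rw [mem_closedBall_zero_iff, show r * (ζ - z) + z = r * ζ + (1 - r) * z by ring]
      refine (norm_add_le _ _).trans ?_
      rw [norm_mul, norm_mul, hr1', norm_real, Real.norm_of_nonneg hr0, hζ1]
      nlinarith
    have hd : dist (r * (ζ - z) + z) ζ < δ := by
      rw [dist_eq_norm, show r * (ζ - z) + z - ζ = (1 - r) * (z - ζ) by ring, norm_mul, hr1']
      have := norm_sub_le z ζ
      nlinarith
    have h1 := (hGδ _ hw _ (sphere_subset_closedBall (hKT hζ)) hd).le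
    rw [dist_eq_norm] at h1
    have h2 := norm_add_le ((derivative^[l] G).eval (r * (ζ - z) + z) - (derivative^[l] G).eval ζ)
      ((derivative^[l] G).eval ζ - (P j).eval ζ)
    rw [sub_add_sub_cancel] at h2
    linarith [hGK ζ hζ]
  have hhalf : (0 : ℝ) ≤ 1 / s / 2 := by positivity
  refine mem_ofPred.2 (lt_of_le_of_lt ?_ (half_lt_self (by positivity : (0 : ℝ) < 1 / s)))
  simp only [iteratedDeriv_polynomial_eval]
  exact Real.iSup_le (fun ζ => Real.iSup_le (fun hζ => Real.iSup_le (fun z => Real.iSup_le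
    (fun hz => hbound ζ hζ z hz) hhalf) hhalf) hhalf) hhalf
end
end
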